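/- arXiv:2201.05031 — 6 statements merged into one kernel-verified Lean document; each statement's English description precedes it below -/
import Mathlib

section
/- Let d ≥ 1, n ∈ ℕ₊ and m_1, …, m_{n+1} ∈ ℕ; set 𝗆 = (m_1+m_{n+1}, m_2, …, m_n) and 𝗆̃ = (m_1+1, m_2, …, m_{n+1}). Let G ∈ L^1(ℝ^d) be such that its periodization 𝐓G is (essentially) bounded, and let V : (ℝ^d)^{n+1} × (ℝ^d)^{1+m_1+…+m_{n+1}} → ℝ be continuous, translationally invariant, periodic-compatible (with respect to the block structure 𝗆̃, the extra y-variable being attached to the first x-variable) and with ‖V‖_{𝒱^{𝗆̃}} < ∞. Define 𝐀(G,V)(x_1,…,x_n; 𝗒_1, 𝗒_{n+1}, 𝗒_2, …, 𝗒_n) := ∫_{ℝ^d}∫_{ℝ^d} V(x_1,…,x_n,x_{n+1}; y, 𝗒_1, …, 𝗒_{n+1}) G(y − x_{n+1}) dy dx_{n+1}, where 𝗒_j ∈ (ℝ^d)^{m_j}. Then 𝐀(G,V) is translationally invariant and ‖𝐀(G,V)‖_{𝒱^{𝗆}} ≤ ‖𝐓G‖_{L^∞(𝕋)} · ‖V‖_{𝒱^{𝗆̃}}.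 -/
open MeasureTheory ENNReal Real

/-- The box `[0,2π)^d`, a fundamental domain of the torus `𝕋 = ℝ^d/(2πℤ)^d`. -/
def box (d : ℕ) : Set (Fin d → ℝ) := Set.univ.pi fun _ => Set.Ico 0 (2 * π)

/-- The norm `‖V‖_{𝒱^𝗆} = sup_{x₁} ∫_{([0,2π)^d)^{n−1}} [V](x₁,…,x_n) dx₂…dx_n` for a
function of `n = q+1` variables in `ℝ^d` and a collection `y : Y` of further variables
(`[V](x) = ∫_Y |V(x;y)| dy`). -/
noncomputable def VnormG (d q : ℕ) {Y : Type} [MeasureSpace Y]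
    (V : (Fin (q + 1) → Fin d → ℝ) → Y → ℝ) : ℝ≥0∞ :=
  ⨆ x1 : Fin d → ℝ, ∫⁻ xr in (Set.univ.pi fun _ : Fin q => box d),
    ∫⁻ y : Y, (‖V (Fin.cons x1 xr) y‖₊ : ℝ≥0∞)

/-- Translation invariance for a function with a distinguished extra y-variable. -/
def TransInvA (d n M : ℕ)
    (V : (Fin n → Fin d → ℝ) → (Fin d → ℝ) → (Fin M → Fin d → ℝ) → ℝ) : Prop :=
  ∀ (x : Fin n → Fin d → ℝ) (yy : Fin d → ℝ) (y : Fin M → Fin d → ℝ) (z : Fin d → ℝ),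
    V (fun j => x j + z) (yy + z) (fun i => y i + z) = V x yy y

/-- Periodic compatibility with respect to a block assignment `b`; the distinguished
extra y-variable is attached to the first x-variable. -/
def PerCompatA (d n M : ℕ) (b : Fin M → Fin n)
    (V : (Fin n → Fin d → ℝ) → (Fin d → ℝ) → (Fin M → Fin d → ℝ) → ℝ)
    (h0 : 0 < n) : Prop :=
  ∀ (x : Fin n → Fin d → ℝ) (yy : Fin d → ℝ) (y : Fin M → Fin d → ℝ)
    (k : Fin n → Fin d → ℤ),
    V (fun j => x j + fun i => 2 * π * (k j i : ℝ))
      (yy + fun i => 2 * π * (k ⟨0, h0⟩ i : ℝ))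
      (fun i0 => y i0 + fun i => 2 * π * (k (b i0) i : ℝ)) = V x yy y

/-- The map `𝐀(G,V)(x₁,…,x_n; y⃗) = ∫∫ V(x₁,…,x_{n+1}; y, y⃗) G(y − x_{n+1}) dy dx_{n+1}`
(the y-variables, encoded by a block assignment, keep their positions; the block of
`x_{n+1}` gets attached to `x₁`). -/
noncomputable def Aop (d p M : ℕ) (G : (Fin d → ℝ) → ℝ)
    (V : (Fin (p + 2) → Fin d → ℝ) → (Fin d → ℝ) → (Fin M → Fin d → ℝ) → ℝ) :
    (Fin (p + 1) → Fin d → ℝ) → (Fin M → Fin d → ℝ) → ℝ :=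
  fun x y => ∫ xn : Fin d → ℝ, ∫ yy : Fin d → ℝ, V (Fin.snoc x xn) yy y * G (yy - xn)

/-- The lattice vector `2πk ∈ (2πℤ)^d`. -/
noncomputable def latticeVec {d : ℕ} (k : Fin d → ℤ) : Fin d → ℝ := fun i => 2 * π * (k i : ℝ)

/-- The integral over `ℝ^d` is the sum over the lattice of integrals over the box. -/
lemma lintegral_eq_tsum_box {d : ℕ} (f : (Fin d → ℝ) → ℝ≥0∞) :
    ∫⁻ x, f x = ∑' k : Fin d → ℤ, ∫⁻ x in box d, f (x + latticeVec k) := by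
  let φ : (Fin d → ℝ) → Fin d → ℤ := fun x i => ⌊x i / (2 * π)⌋
  have hφ : Measurable φ :=
    measurable_pi_lambda _ fun i => Int.measurable_floor.comp ((measurable_pi_apply i).div_const _)
  have huniv : (⋃ k, φ ⁻¹' {k}) = Set.univ := by
    ext x; simp
  rw [← setLIntegral_univ f, ← huniv, lintegral_iUnion
    (fun k => hφ (measurableSet_singleton k))
    (fun k l hkl => Set.disjoint_left.2 fun x hk hl => hkl (hk.symm.trans hl))]
  refine tsum_congr fun k => ?_
  have hpre : (fun x => x + latticeVec k) ⁻¹' (φ ⁻¹' {k}) = box d := by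
    ext x
    simp only [Set.mem_preimage, Set.mem_singleton_iff, funext_iff, box, Set.mem_pi, Set.mem_univ,
      true_imp_iff, φ, latticeVec, Pi.add_apply]
    refine forall_congr' fun i => ?_
    have h2 : (0 : ℝ) < 2 * π := by positivity
    rw [add_div, mul_div_cancel_left₀ _ h2.ne', Int.floor_add_intCast, add_eq_right,
      Int.floor_eq_zero_iff, Set.mem_Ico, Set.mem_Ico, le_div_iff₀ h2, div_lt_iff₀ h2, zero_mul,
      one_mul]
  rw [← hpre, (measurePreserving_add_right volume (latticeVec k)).setLIntegral_comp_preimage_emb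
    (measurableEmbedding_addRight _)]

/-- Splitting off the last variable in an integral over a power of the box. -/
lemma setLIntegral_box_snoc {d p : ℕ} {f : (Fin (p + 1) → Fin d → ℝ) → ℝ≥0∞}
    (hf : Measurable f) :
    ∫⁻ x in Set.univ.pi fun _ : Fin (p + 1) => box d, f x =
      ∫⁻ xr in Set.univ.pi fun _ : Fin p => box d, ∫⁻ xn in box d, f (Fin.snoc xr xn) := by
  let e := MeasurableEquiv.piFinSuccAbove (fun _ : Fin (p + 1) => Fin d → ℝ) (Fin.last p)
  have he : MeasurePreserving e.symm :=
    (volume_preserving_piFinSuccAbove (fun _ : Fin (p + 1) => Fin d → ℝ) (Fin.last p)).symm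
  have hsymm : ∀ z, e.symm z = Fin.snoc z.2 z.1 := fun z => by
    simp [e, MeasurableEquiv.piFinSuccAbove, Fin.insertNthEquiv, Fin.insertNth_last']
  have hpre : e.symm ⁻¹' (Set.univ.pi fun _ : Fin (p + 1) => box d) =
      box d ×ˢ Set.univ.pi fun _ : Fin p => box d := by
    ext z
    simp only [Set.mem_preimage, hsymm, Set.mem_pi, Set.mem_univ, true_imp_iff, Set.mem_prod,
      Fin.forall_fin_succ', Fin.snoc_castSucc, Fin.snoc_last]
    exact and_comm
  rw [← he.setLIntegral_comp_preimage_emb e.symm.measurableEmbedding, hpre,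
    Measure.volume_eq_prod, ← Measure.prod_restrict]
  simpa only [Function.comp_apply, hsymm] using
    lintegral_prod_symm' _ (hf.comp e.symm.measurable)

lemma measurable_snoc {d p : ℕ} :
    Measurable fun z : (Fin p → Fin d → ℝ) × (Fin d → ℝ) =>
      (Fin.snoc z.1 z.2 : Fin (p + 1) → Fin d → ℝ) :=
  (Continuous.finSnoc continuous_fst continuous_snd).measurable

/-- Periodic compatibility when only the last `x`-variable is moved. -/
lemma PerCompatA.snoc_add {d p M : ℕ} {b : Fin M → Fin (p + 2)}
    {V : (Fin (p + 2) → Fin d → ℝ) → (Fin d → ℝ) → (Fin M → Fin d → ℝ) → ℝ}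
    (hpc : PerCompatA d (p + 2) M b V (Nat.succ_pos _))
    (x : Fin (p + 1) → Fin d → ℝ) (xn yy : Fin d → ℝ) (y : Fin M → Fin d → ℝ) (k : Fin d → ℤ) :
    V (Fin.snoc x (xn + latticeVec k)) yy
      (y + fun i => if b i = Fin.last (p + 1) then latticeVec k else 0) =
        V (Fin.snoc x xn) yy y := by
  rw [← hpc (Fin.snoc x xn) yy y fun j => if j = Fin.last (p + 1) then k else 0]
  congr 1
  · ext j i
    refine Fin.lastCases ?_ (fun j => ?_) j
    · simp [latticeVec]
    · simp [(Fin.castSucc_lt_last j).ne]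
  · ext i
    simp
  · ext j i
    by_cases hj : b j = Fin.last (p + 1) <;> simp [hj, latticeVec]

/-- Integrating out the contracted variable against a kernel whose periodization is bounded. -/
lemma lintegral_contraction_le {d p M : ℕ} {b : Fin M → Fin (p + 2)}
    {V : (Fin (p + 2) → Fin d → ℝ) → (Fin d → ℝ) → (Fin M → Fin d → ℝ) → ℝ}
    (hV : Measurable fun q :
      (Fin (p + 2) → Fin d → ℝ) × (Fin d → ℝ) × (Fin M → Fin d → ℝ) => V q.1 q.2.1 q.2.2)
    (hpc : PerCompatA d (p + 2) M b V (Nat.succ_pos _))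
    {g : (Fin d → ℝ) → ℝ≥0∞} (hg : Measurable g) {C : ℝ≥0∞}
    (hC : ∀ᵐ z, ∑' k : Fin d → ℤ, g (z + latticeVec k) ≤ C) (x : Fin (p + 1) → Fin d → ℝ) :
    ∫⁻ y, ∫⁻ xn, ∫⁻ yy, ‖V (Fin.snoc x xn) yy y‖ₑ * g (yy - xn) ≤
      C * ∫⁻ xn in box d, ∫⁻ q : (Fin d → ℝ) × (Fin M → Fin d → ℝ),
        ‖V (Fin.snoc x xn) q.1 q.2‖ₑ := by
  have hF : Measurable fun q : (Fin d → ℝ) × (Fin d → ℝ) × (Fin M → Fin d → ℝ) =>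
      ‖V (Fin.snoc x q.1) q.2.1 q.2.2‖ₑ :=
    (hV.comp ((measurable_snoc.comp (measurable_const.prodMk measurable_fst)).prodMk
      measurable_snd)).enorm
  have hI : ∀ c : Fin d → ℝ, Measurable fun q : (Fin d → ℝ) × (Fin d → ℝ) × (Fin M → Fin d → ℝ) =>
      ‖V (Fin.snoc x q.1) q.2.1 q.2.2‖ₑ * g (q.2.1 - (q.1 + c)) := fun c =>
    hF.mul (hg.comp (by fun_prop))
  have hF' : ∀ xn, Measurable fun q : (Fin d → ℝ) × (Fin M → Fin d → ℝ) =>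
      ‖V (Fin.snoc x xn) q.1 q.2‖ₑ := fun xn => hF.comp (measurable_const.prodMk measurable_id)
  have hI' : ∀ c xn : Fin d → ℝ, Measurable fun q : (Fin d → ℝ) × (Fin M → Fin d → ℝ) =>
      ‖V (Fin.snoc x xn) q.1 q.2‖ₑ * g (q.1 - (xn + c)) := fun c xn =>
    (hI c).comp (measurable_const.prodMk measurable_id)
  have hswap : ∀ c : Fin d → ℝ, ∀ xn, ∫⁻ y, ∫⁻ yy, ‖V (Fin.snoc x xn) yy y‖ₑ * g (yy - (xn + c)) =
      ∫⁻ q : (Fin d → ℝ) × (Fin M → Fin d → ℝ),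
        ‖V (Fin.snoc x xn) q.1 q.2‖ₑ * g (q.1 - (xn + c)) := fun c xn => by
    rw [Measure.volume_eq_prod, lintegral_prod_symm' _ (hI' c xn)]
  have hmeas : Measurable fun z : (Fin M → Fin d → ℝ) × (Fin d → ℝ) =>
      ∫⁻ yy, ‖V (Fin.snoc x z.2) yy z.1‖ₑ * g (yy - z.2) := by
    refine Measurable.lintegral_prod_right' (f := fun w : ((Fin M → Fin d → ℝ) × (Fin d → ℝ)) ×
      (Fin d → ℝ) => ‖V (Fin.snoc x w.1.2) w.2 w.1.1‖ₑ * g (w.2 - w.1.2)) ?_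
    have h : Measurable fun w : ((Fin M → Fin d → ℝ) × (Fin d → ℝ)) × (Fin d → ℝ) =>
      (w.1.2, w.2, w.1.1) := by fun_prop
    simpa [Function.comp_def] using (hI 0).comp h
  calc ∫⁻ y, ∫⁻ xn, ∫⁻ yy, ‖V (Fin.snoc x xn) yy y‖ₑ * g (yy - xn)
      = ∫⁻ xn, ∫⁻ y, ∫⁻ yy, ‖V (Fin.snoc x xn) yy y‖ₑ * g (yy - xn) :=
        lintegral_lintegral_swap hmeas.aemeasurable
    _ = ∑' k, ∫⁻ xn in box d, ∫⁻ y, ∫⁻ yy,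
          ‖V (Fin.snoc x (xn + latticeVec k)) yy y‖ₑ * g (yy - (xn + latticeVec k)) :=
        lintegral_eq_tsum_box _
    _ = ∑' k, ∫⁻ xn in box d, ∫⁻ q : (Fin d → ℝ) × (Fin M → Fin d → ℝ),
          ‖V (Fin.snoc x xn) q.1 q.2‖ₑ * g (q.1 - (xn + latticeVec k)) := by
        refine tsum_congr fun k => lintegral_congr fun xn => ?_
        rw [← hswap, ← lintegral_add_right_eq_self _
          (fun i => if b i = Fin.last (p + 1) then latticeVec k else 0)]
        simp only [hpc.snoc_add]
    _ = ∫⁻ xn in box d, ∫⁻ q : (Fin d → ℝ) × (Fin M → Fin d → ℝ),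
          ‖V (Fin.snoc x xn) q.1 q.2‖ₑ * ∑' k, g (q.1 - (xn + latticeVec k)) := by
        rw [← lintegral_tsum fun k => ((hI (latticeVec k)).lintegral_prod_right').aemeasurable]
        refine lintegral_congr fun xn => ?_
        simp only
        rw [← lintegral_tsum fun k => (hI' (latticeVec k) xn).aemeasurable]
        simp only [ENNReal.tsum_mul_left]
    _ ≤ ∫⁻ xn in box d, ∫⁻ q : (Fin d → ℝ) × (Fin M → Fin d → ℝ),
          ‖V (Fin.snoc x xn) q.1 q.2‖ₑ * C := by
        refine lintegral_mono fun xn => lintegral_mono_ae ?_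
        have h1 : ∀ᵐ yy : Fin d → ℝ, ∑' k, g (yy - xn + latticeVec k) ≤ C :=
          (measurePreserving_sub_right volume xn).quasiMeasurePreserving.ae hC
        have h2 := (Measure.quasiMeasurePreserving_fst
          (μ := (volume : Measure (Fin d → ℝ)))
          (ν := (volume : Measure (Fin M → Fin d → ℝ)))).ae h1
        rw [Measure.volume_eq_prod]
        filter_upwards [h2] with q hq
        gcongr
        rw [← (Equiv.neg (Fin d → ℤ)).tsum_eq] at hq
        refine le_of_eq_of_le (tsum_congr fun k => congrArg g ?_) hq
        ext i
        simp [latticeVec]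
        ring
    _ = C * ∫⁻ xn in box d, ∫⁻ q : (Fin d → ℝ) × (Fin M → Fin d → ℝ),
          ‖V (Fin.snoc x xn) q.1 q.2‖ₑ := by
        rw [← lintegral_const_mul _ hF.lintegral_prod_right']
        refine lintegral_congr fun xn => ?_
        rw [lintegral_mul_const _ (hF' xn), mul_comm]

lemma Aop_add {d p M : ℕ} (G : (Fin d → ℝ) → ℝ)
    {V : (Fin (p + 2) → Fin d → ℝ) → (Fin d → ℝ) → (Fin M → Fin d → ℝ) → ℝ}
    (hti : TransInvA d (p + 2) M V)
    (x : Fin (p + 1) → Fin d → ℝ) (y : Fin M → Fin d → ℝ) (z : Fin d → ℝ) :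
    Aop d p M G V (fun j => x j + z) (fun i => y i + z) = Aop d p M G V x y := by
  unfold Aop
  rw [← integral_add_right_eq_self _ z]
  refine integral_congr_ae (.of_forall fun xn => ?_)
  simp only
  rw [← integral_add_right_eq_self _ z]
  refine integral_congr_ae (.of_forall fun yy => ?_)
  simp only
  rw [add_sub_add_right_eq_sub, ← hti (Fin.snoc x xn) yy y z]
  congr 2
  ext j i
  refine Fin.lastCases ?_ (fun j => ?_) j <;> simp

/-- Pointwise bound of `𝐀(G,V)` by an integral of norms, with `‖G‖` replaced by any almost
everywhere equal function. -/
lemma enorm_Aop_le {d p M : ℕ} {G : (Fin d → ℝ) → ℝ} {g : (Fin d → ℝ) → ℝ≥0∞}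
    (hGg : (fun z => ‖G z‖ₑ) =ᵐ[volume] g)
    (V : (Fin (p + 2) → Fin d → ℝ) → (Fin d → ℝ) → (Fin M → Fin d → ℝ) → ℝ)
    (x : Fin (p + 1) → Fin d → ℝ) (y : Fin M → Fin d → ℝ) :
    ‖Aop d p M G V x y‖ₑ ≤
      ∫⁻ xn, ∫⁻ yy, ‖V (Fin.snoc x xn) yy y‖ₑ * g (yy - xn) := by
  refine (enorm_integral_le_lintegral_enorm _).trans (lintegral_mono fun xn =>
    (enorm_integral_le_lintegral_enorm _).trans (lintegral_mono_ae ?_))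
  filter_upwards [(measurePreserving_sub_right volume xn).quasiMeasurePreserving.ae hGg] with yy h
  rw [enorm_mul, h]

/-- if `𝐓G` is essentially bounded and `V` is continuous, translationally
invariant, periodic-compatible with finite norm, then `𝐀(G,V)` is translationally
invariant and `‖𝐀(G,V)‖_{𝒱^𝗆} ≤ ‖𝐓G‖_{L^∞(𝕋)} ‖V‖_{𝒱^𝗆̃}`. -/
theorem stmt1 (d p M : ℕ) (hd : 1 ≤ d)
    (G : (Fin d → ℝ) → ℝ) (hG : Integrable G)
    (hTG : essSup (fun x : Fin d → ℝ =>
      ∑' k : Fin d → ℤ, (‖G (x + fun i => 2 * π * (k i : ℝ))‖₊ : ℝ≥0∞)) volume < ⊤)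
    (b : Fin M → Fin (p + 2))
    (V : (Fin (p + 2) → Fin d → ℝ) → (Fin d → ℝ) → (Fin M → Fin d → ℝ) → ℝ)
    (hcont : Continuous fun q :
      (Fin (p + 2) → Fin d → ℝ) × (Fin d → ℝ) × (Fin M → Fin d → ℝ) => V q.1 q.2.1 q.2.2)
    (hti : TransInvA d (p + 2) M V)
    (hpc : PerCompatA d (p + 2) M b V (Nat.succ_pos _))
    (hfin : VnormG d (p + 1)
      (fun x (q : (Fin d → ℝ) × (Fin M → Fin d → ℝ)) => V x q.1 q.2) < ⊤) :
    (∀ (x : Fin (p + 1) → Fin d → ℝ) (y : Fin M → Fin d → ℝ) (z : Fin d → ℝ),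
      Aop d p M G V (fun j => x j + z) (fun i => y i + z) = Aop d p M G V x y) ∧
    VnormG d p (Aop d p M G V) ≤
      essSup (fun x : Fin d → ℝ =>
          ∑' k : Fin d → ℤ, (‖G (x + fun i => 2 * π * (k i : ℝ))‖₊ : ℝ≥0∞)) volume *
        VnormG d (p + 1) (fun x (q : (Fin d → ℝ) × (Fin M → Fin d → ℝ)) => V x q.1 q.2) := by
  refine ⟨Aop_add G hti, iSup_le fun x1 => ?_⟩
  obtain ⟨g, hg, hGg⟩ := hG.aestronglyMeasurable.enorm
  set C := essSup (fun x : Fin d → ℝ =>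
    ∑' k : Fin d → ℤ, (‖G (x + fun i => 2 * π * (k i : ℝ))‖₊ : ℝ≥0∞)) volume
  have hC : ∀ᵐ z, ∑' k : Fin d → ℤ, g (z + latticeVec k) ≤ C := by
    have hk : ∀ᵐ z : Fin d → ℝ, ∀ k : Fin d → ℤ,
        ‖G (z + latticeVec k)‖ₑ = g (z + latticeVec k) :=
      ae_all_iff.2 fun k =>
        (measurePreserving_add_right volume (latticeVec k)).quasiMeasurePreserving.ae hGg
    filter_upwards [hk, ENNReal.ae_le_essSup (μ := volume) (fun x : Fin d → ℝ =>
      ∑' k : Fin d → ℤ, (‖G (x + fun i => 2 * π * (k i : ℝ))‖₊ : ℝ≥0∞))] with z hz hz'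
    exact le_of_eq_of_le (tsum_congr fun k => (hz k).symm) hz'
  have hV := hcont.measurable
  have hcons : Measurable fun xr : Fin (p + 1) → Fin d → ℝ =>
      (Fin.cons x1 xr : Fin (p + 2) → Fin d → ℝ) :=
    (Continuous.finCons continuous_const continuous_id).measurable
  have hN : Measurable fun xr : Fin (p + 1) → Fin d → ℝ =>
      ∫⁻ q : (Fin d → ℝ) × (Fin M → Fin d → ℝ),
        (‖V (Fin.cons x1 xr) q.1 q.2‖₊ : ℝ≥0∞) :=
    Measurable.lintegral_prod_right' (f := fun w : (Fin (p + 1) → Fin d → ℝ) ×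
      (Fin d → ℝ) × (Fin M → Fin d → ℝ) => ‖V (Fin.cons x1 w.1) w.2.1 w.2.2‖ₑ)
      (hV.comp ((hcons.comp measurable_fst).prodMk measurable_snd)).enorm
  have hN' : Measurable fun xr : Fin p → Fin d → ℝ => ∫⁻ xn in box d,
      ∫⁻ q : (Fin d → ℝ) × (Fin M → Fin d → ℝ),
        (‖V (Fin.cons x1 (Fin.snoc xr xn : Fin (p + 1) → Fin d → ℝ)) q.1 q.2‖₊ : ℝ≥0∞) :=
    (hN.comp measurable_snoc).lintegral_prod_right'
  calc ∫⁻ xr in Set.univ.pi fun _ : Fin p => box d, ∫⁻ y,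
        (‖Aop d p M G V (Fin.cons x1 xr) y‖₊ : ℝ≥0∞)
      ≤ ∫⁻ xr in Set.univ.pi fun _ : Fin p => box d, C * ∫⁻ xn in box d,
          ∫⁻ q : (Fin d → ℝ) × (Fin M → Fin d → ℝ),
            (‖V (Fin.cons x1 (Fin.snoc xr xn : Fin (p + 1) → Fin d → ℝ)) q.1 q.2‖₊ : ℝ≥0∞) := by
        refine lintegral_mono fun xr => (lintegral_mono fun y => enorm_Aop_le hGg V _ y).trans ?_
        simp only [Fin.cons_snoc_eq_snoc_cons]
        exact lintegral_contraction_le hV hpc hg hC _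
    _ = C * ∫⁻ xr in Set.univ.pi fun _ : Fin (p + 1) => box d,
          ∫⁻ q : (Fin d → ℝ) × (Fin M → Fin d → ℝ),
            (‖V (Fin.cons x1 xr) q.1 q.2‖₊ : ℝ≥0∞) := by
        rw [lintegral_const_mul _ hN', setLIntegral_box_snoc hN]
    _ ≤ _ := by
        gcongr
        exact le_iSup (fun x1 : Fin d → ℝ => ∫⁻ xr in Set.univ.pi fun _ : Fin (p + 1) => box d,
          ∫⁻ q : (Fin d → ℝ) × (Fin M → Fin d → ℝ),
            (‖V (Fin.cons x1 xr) q.1 q.2‖₊ : ℝ≥0∞)) x1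
end

section
/- Let d ≥ 1, n ∈ ℕ₊, n̂ ∈ {1,…,n} and m_1,…,m_{n+1} ∈ ℕ; set 𝗆 = (m_1+m_{n+1}, m_2, …, m_n), 𝗆̂ = (m_1+1, m_2, …, m_{n̂}) and 𝗆̌ = (m_{n̂+1}, …, m_{n+1}). Let G ∈ L^1(ℝ^d), and let W : (ℝ^d)^{n̂} × (ℝ^d)^{1+m_1+…+m_{n̂}} → ℝ and U : (ℝ^d)^{n−n̂+1} × (ℝ^d)^{m_{n̂+1}+…+m_{n+1}} → ℝ be continuous, translationally invariant, periodic-compatible (with respect to the block structures 𝗆̂ and 𝗆̌) and with ‖W‖_{𝒱^{𝗆̂}} < ∞, ‖U‖_{𝒱^{𝗆̌}} < ∞. Define 𝐁(G,W,U)(x_1,…,x_n; 𝗒_1, 𝗒_{n+1}, 𝗒_2, …, 𝗒_n) := ∫_{ℝ^d}∫_{ℝ^d} W(x_1,…,x_{n̂}; y, 𝗒_1, …, 𝗒_{n̂}) G(y − x_{n+1}) U(x_{n̂+1},…,x_{n+1}; 𝗒_{n̂+1}, …, 𝗒_{n+1}) dy dx_{n+1}, where 𝗒_j ∈ (ℝ^d)^{m_j}.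 Then 𝐁(G,W,U) is translationally invariant and ‖𝐁(G,W,U)‖_{𝒱^{𝗆}} ≤ ‖G‖_{L^1(ℝ^d)} · ‖W‖_{𝒱^{𝗆̂}} · ‖U‖_{𝒱^{𝗆̌}}. -/
open MeasureTheory ENNReal Real

/-- Translation invariance. -/
def TransInv (d n M : ℕ) (V : (Fin n → Fin d → ℝ) → (Fin M → Fin d → ℝ) → ℝ) : Prop :=
  ∀ (x : Fin n → Fin d → ℝ) (y : Fin M → Fin d → ℝ) (z : Fin d → ℝ),
    V (fun j => x j + z) (fun i => y i + z) = V x y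

/-- Periodic compatibility with respect to a block assignment `b`. -/
def PerCompat (d n M : ℕ) (b : Fin M → Fin n)
    (V : (Fin n → Fin d → ℝ) → (Fin M → Fin d → ℝ) → ℝ) : Prop :=
  ∀ (x : Fin n → Fin d → ℝ) (y : Fin M → Fin d → ℝ) (k : Fin n → Fin d → ℤ),
    V (fun j => x j + fun i => 2 * π * (k j i : ℝ))
      (fun i0 => y i0 + fun i => 2 * π * (k (b i0) i : ℝ)) = V x y

/-- The map `𝐁(G,W,U)` of Statement 2: with `n̂ = q+1` and `n = q+1+r`,
`𝐁(G,W,U)(x₁,…,x_n; ⋅) = ∫∫ W(x₁,…,x_{n̂}; y, ⋅) G(y − x_{n+1}) U(x_{n̂+1},…,x_{n+1}; ⋅) dy dx_{n+1}`. -/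
noncomputable def Bop (d q r MW MU : ℕ) (G : (Fin d → ℝ) → ℝ)
    (W : (Fin (q + 1) → Fin d → ℝ) → (Fin d → ℝ) → (Fin MW → Fin d → ℝ) → ℝ)
    (U : (Fin (r + 1) → Fin d → ℝ) → (Fin MU → Fin d → ℝ) → ℝ) :
    (Fin (q + r + 1) → Fin d → ℝ) → (Fin MW → Fin d → ℝ) → (Fin MU → Fin d → ℝ) → ℝ :=
  fun x yW yU => ∫ xn : Fin d → ℝ, ∫ yy : Fin d → ℝ,
    W (fun j : Fin (q + 1) => x ⟨j.1, by omega⟩) yy yW * G (yy - xn) *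
      U (Fin.snoc (fun j : Fin r => x ⟨q + 1 + j.1, by omega⟩) xn) yU

/-- The lattice `(2πℤ)^{r × d}` inside `(ℝ^d)^r`. -/
noncomputable def periodLattice (r d : ℕ) : AddSubgroup (Fin r → Fin d → ℝ) :=
  (AddMonoidHom.mk' (fun (k : Fin r → Fin d → ℤ) j i => 2 * π * (k j i : ℝ)) (by
    intro a b
    funext j i
    simp [mul_add])).range

instance (r d : ℕ) : Countable (periodLattice r d) :=
  (Set.countable_range _).to_subtype

theorem measurableSet_box (d : ℕ) : MeasurableSet (box d) :=
  MeasurableSet.univ_pi fun _ => measurableSet_Ico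

theorem measurableSet_pi_box (r d : ℕ) :
    MeasurableSet (Set.univ.pi fun _ : Fin r => box d) :=
  MeasurableSet.univ_pi fun _ => measurableSet_box d

theorem volume_box (d : ℕ) : volume (box d) = ENNReal.ofReal (2 * π) ^ d := by
  simp [box, volume_pi_pi]

theorem isAddFundamentalDomain_preimage_pi_box (r d : ℕ) (c : Fin r → Fin d → ℝ) :
    IsAddFundamentalDomain (periodLattice r d)
      ((fun x => x - c) ⁻¹' (Set.univ.pi fun _ : Fin r => box d)) := by
  refine IsAddFundamentalDomain.mk'
    (measurable_sub_const c (measurableSet_pi_box r d)).nullMeasurableSet fun x => ?_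
  have key := fun j i => existsUnique_add_zsmul_mem_Ico two_pi_pos (x j i - c j i) 0
  choose k hk huniq using key
  refine ⟨⟨_, k, rfl⟩, ?_, ?_⟩
  · intro j _ i _
    have := hk j i
    simp only [zero_add, zsmul_eq_mul] at this
    convert this using 1
    simp [AddSubgroup.vadd_def]
    ring
  · rintro ⟨_, k', rfl⟩ hk'
    have : k' = k := by
      funext j i
      refine huniq j i _ ?_
      have := hk' j trivial i trivial
      simp only [zero_add, zsmul_eq_mul]
      convert this using 1
      simp [AddSubgroup.vadd_def]
      ring
    subst this
    rfl

/-- The integral of a periodic function over a period box is invariant under translation. -/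
theorem setLIntegral_pi_box_add (r d : ℕ) (F : (Fin r → Fin d → ℝ) → ℝ≥0∞)
    (hF : ∀ (x : Fin r → Fin d → ℝ) (k : Fin r → Fin d → ℤ),
      F (fun j => x j + fun i => 2 * π * (k j i : ℝ)) = F x) (c : Fin r → Fin d → ℝ) :
    ∫⁻ x in (Set.univ.pi fun _ : Fin r => box d), F (x + c) =
      ∫⁻ x in (Set.univ.pi fun _ : Fin r => box d), F x := by
  have h0 := isAddFundamentalDomain_preimage_pi_box r d 0
  simp only [sub_zero, Set.preimage_id'] at h0
  rw [← (isAddFundamentalDomain_preimage_pi_box r d c).setLIntegral_eq h0 F ?_]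
  · rw [← (measurePreserving_add_right volume c).setLIntegral_comp_preimage_emb
      (measurableEmbedding_addRight c) F]
    simp [Set.preimage_preimage]
  · rintro ⟨_, k, rfl⟩ x
    rw [← hF x k]
    congr 1
    funext j i
    simp [AddSubgroup.vadd_def, add_comm]

theorem setLIntegral_box_insertNth (r d : ℕ) (h : (Fin (r + 1) → Fin d → ℝ) → ℝ≥0∞)
    (hm : Measurable h) (i : Fin (r + 1)) :
    ∫⁻ u in box d, ∫⁻ x in (Set.univ.pi fun _ : Fin r => box d), h (i.insertNth u x) =
      ∫⁻ x in (Set.univ.pi fun _ : Fin (r + 1) => box d), h x := by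
  have hp := (volume_preserving_piFinSuccAbove (fun _ : Fin (r + 1) => Fin d → ℝ) i).symm
  rw [← hp.setLIntegral_comp_preimage_emb (MeasurableEquiv.measurableEmbedding _)]
  have hs : (MeasurableEquiv.piFinSuccAbove (fun _ : Fin (r + 1) => Fin d → ℝ) i).symm ⁻¹'
      (Set.univ.pi fun _ => box d) = box d ×ˢ (Set.univ.pi fun _ : Fin r => box d) := by
    ext p
    change i.insertNth (α := fun _ => Fin d → ℝ) p.1 p.2 ∈
      (Set.univ.pi fun _ => box d) ↔ _
    simp [Fin.forall_iff_succAbove i]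
  rw [hs, Measure.volume_eq_prod, ← Measure.prod_restrict, lintegral_prod]
  · rfl
  · exact (hm.comp (MeasurableEquiv.measurable _)).aemeasurable

/-- For a translation invariant periodic function, fixing the last variable instead of the first
one does not increase the supremum of the box integrals. -/
theorem setLIntegral_snoc_le_iSup_cons (r d : ℕ) (h : (Fin (r + 1) → Fin d → ℝ) → ℝ≥0∞)
    (hm : Measurable h)
    (ht : ∀ (x : Fin (r + 1) → Fin d → ℝ) (z : Fin d → ℝ), h (fun j => x j + z) = h x)
    (hp : ∀ (x : Fin (r + 1) → Fin d → ℝ) (k : Fin (r + 1) → Fin d → ℤ),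
      h (fun j => x j + fun i => 2 * π * (k j i : ℝ)) = h x) (v : Fin d → ℝ) :
    ∫⁻ x in (Set.univ.pi fun _ : Fin r => box d), h (Fin.snoc x v : Fin (r + 1) → Fin d → ℝ) ≤
      ⨆ u : Fin d → ℝ, ∫⁻ x in (Set.univ.pi fun _ : Fin r => box d), h (Fin.cons u x) := by
  have hconst : ∀ u : Fin d → ℝ,
      ∫⁻ x in (Set.univ.pi fun _ : Fin r => box d),
        h (Fin.snoc x u : Fin (r + 1) → Fin d → ℝ) =
      ∫⁻ x in (Set.univ.pi fun _ : Fin r => box d),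
        h (Fin.snoc x v : Fin (r + 1) → Fin d → ℝ) := by
    intro u
    rw [← setLIntegral_pi_box_add r d
      (fun x => h (Fin.snoc x u : Fin (r + 1) → Fin d → ℝ)) ?_ (fun _ => u - v)]
    · refine lintegral_congr fun x => ?_
      rw [← ht (Fin.snoc x v) (u - v)]
      congr 1
      funext j
      refine Fin.lastCases ?_ (fun j => ?_) j <;> simp
    · intro x k
      rw [← hp (Fin.snoc x u) (Fin.snoc k 0 : Fin (r + 1) → Fin d → ℤ)]
      congr 1
      funext j
      refine Fin.lastCases ?_ (fun j => ?_) j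
      · simp [← Pi.zero_def]
      · simp
  have hpos : volume (box d) ≠ 0 := by
    rw [volume_box]
    exact pow_ne_zero _ (by simp [pi_pos])
  have hfin : volume (box d) ≠ ⊤ := by
    rw [volume_box]
    exact ENNReal.pow_ne_top ENNReal.ofReal_ne_top
  rw [← ENNReal.mul_le_mul_iff_left hpos hfin, ← setLIntegral_const, ← setLIntegral_const]
  calc _ = ∫⁻ u in box d, ∫⁻ x in (Set.univ.pi fun _ : Fin r => box d),
        h ((Fin.last r).insertNth u x) := by
          simp only [Fin.insertNth_last']
          exact lintegral_congr fun u => (hconst u).symm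
    _ = ∫⁻ u in box d, ∫⁻ x in (Set.univ.pi fun _ : Fin r => box d),
        h ((0 : Fin (r + 1)).insertNth u x) := by
          rw [setLIntegral_box_insertNth r d h hm, setLIntegral_box_insertNth r d h hm]
    _ ≤ _ := by
          simp only [Fin.insertNth_zero']
          exact lintegral_mono fun u => le_iSup
            (fun u : Fin d → ℝ => ∫⁻ x in (Set.univ.pi fun _ : Fin r => box d),
              h (Fin.cons u x)) u

/-- Splitting the first `q` from the last `r` variables preserves Lebesgue measure. -/
theorem measurePreserving_castAdd_natAdd (q r d : ℕ) :
    MeasurePreserving (fun x : Fin (q + r) → Fin d → ℝ =>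
      ((fun i => x (Fin.castAdd r i), fun j => x (Fin.natAdd q j)) :
        (Fin q → Fin d → ℝ) × (Fin r → Fin d → ℝ))) := by
  have h := (volume_measurePreserving_sumPiEquivProdPi
    (fun _ : Fin q ⊕ Fin r => Fin d → ℝ)).comp
    (volume_measurePreserving_piCongrLeft (fun _ : Fin (q + r) => Fin d → ℝ)
      finSumFinEquiv).symm
  exact h

theorem setLIntegral_pi_box_split (q r d : ℕ)
    (Φ : (Fin q → Fin d → ℝ) × (Fin r → Fin d → ℝ) → ℝ≥0∞) (hΦ : Measurable Φ) :
    ∫⁻ x in (Set.univ.pi fun _ : Fin (q + r) => box d),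
        Φ (fun i => x (Fin.castAdd r i), fun j => x (Fin.natAdd q j)) =
      ∫⁻ a in (Set.univ.pi fun _ : Fin q => box d),
        ∫⁻ b in (Set.univ.pi fun _ : Fin r => box d), Φ (a, b) := by
  have hs : (Set.univ.pi fun _ : Fin (q + r) => box d) =
      (fun x : Fin (q + r) → Fin d → ℝ =>
        ((fun i => x (Fin.castAdd r i), fun j => x (Fin.natAdd q j)) :
          (Fin q → Fin d → ℝ) × (Fin r → Fin d → ℝ))) ⁻¹'
      ((Set.univ.pi fun _ : Fin q => box d) ×ˢ (Set.univ.pi fun _ : Fin r => box d)) := by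
    ext x
    simp [Fin.forall_fin_add]
  rw [hs, (measurePreserving_castAdd_natAdd q r d).setLIntegral_comp_preimage
    ((measurableSet_pi_box q d).prod (measurableSet_pi_box r d)) hΦ,
    Measure.volume_eq_prod, ← Measure.prod_restrict, lintegral_prod _ hΦ.aemeasurable]

/-- A Schur-type bound for a composition of three nonnegative kernels. -/
theorem lintegral_kernel_comp_le {β γ δ η ε : Type*} [MeasurableSpace β] [MeasurableSpace γ]
    [MeasurableSpace δ] [MeasurableSpace η] [MeasurableSpace ε]
    (μ : Measure β) (ν : Measure γ) (ρ : Measure δ) (τ : Measure η) (σ : Measure ε)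
    [SFinite μ] [SFinite ν] [SFinite ρ] [SFinite τ] [SFinite σ]
    (f : ε × γ → ℝ≥0∞) (k : ε × η → ℝ≥0∞) (u : β × η × δ → ℝ≥0∞)
    (hf : Measurable f) (hk : Measurable k) (hu : Measurable u) (C N : ℝ≥0∞)
    (hC : ∀ y, ∫⁻ x, k (y, x) ∂τ ≤ C) (hN : ∀ x, ∫⁻ b, ∫⁻ z, u (b, x, z) ∂ρ ∂μ ≤ N) :
    ∫⁻ b, ∫⁻ w, ∫⁻ x, ∫⁻ y, f (y, w.1) * k (y, x) * u (b, x, w.2) ∂σ ∂τ ∂(ν.prod ρ) ∂μ ≤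
      C * (∫⁻ p, f p ∂(σ.prod ν)) * N := by
  have hc : Measurable fun p : γ × η => ∫⁻ y, f (y, p.1) * k (y, p.2) ∂σ :=
    Measurable.lintegral_prod_right' (f := fun p : (γ × η) × ε =>
      f (p.2, p.1.1) * k (p.2, p.1.2)) (by fun_prop)
  set c : γ × η → ℝ≥0∞ := fun p => ∫⁻ y, f (y, p.1) * k (y, p.2) ∂σ with hcdef
  have hU : Measurable fun p : β × η => ∫⁻ z, u (p.1, p.2, z) ∂ρ :=
    Measurable.lintegral_prod_right' (f := fun p : (β × η) × δ => u (p.1.1, p.1.2, p.2))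
      (by fun_prop)
  have h1 : ∀ b (w : γ × δ), ∫⁻ x, ∫⁻ y, f (y, w.1) * k (y, x) * u (b, x, w.2) ∂σ ∂τ =
      ∫⁻ x, c (w.1, x) * u (b, x, w.2) ∂τ := fun b w =>
    lintegral_congr fun x => lintegral_mul_const _
      (by fun_prop : Measurable fun y => f (y, w.1) * k (y, x))
  have h2 : ∀ b, ∫⁻ w, ∫⁻ x, c (w.1, x) * u (b, x, w.2) ∂τ ∂(ν.prod ρ) =
      ∫⁻ g, ∫⁻ x, c (g, x) * ∫⁻ z, u (b, x, z) ∂ρ ∂τ ∂ν := by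
    intro b
    rw [lintegral_prod]
    · refine lintegral_congr fun g => ?_
      rw [lintegral_lintegral_swap (by fun_prop)]
      exact lintegral_congr fun x => lintegral_const_mul (c (g, x))
        (by fun_prop : Measurable fun z => u (b, x, z))
    · exact (Measurable.lintegral_prod_right' (f := fun p : (γ × δ) × η =>
        c (p.1.1, p.2) * u (b, p.2, p.1.2)) (by fun_prop)).aemeasurable
  simp only [h1, h2]
  rw [lintegral_lintegral_swap]
  swap
  · exact (Measurable.lintegral_prod_right' (f := fun p : (β × γ) × η =>
      c (p.1.2, p.2) * ∫⁻ z, u (p.1.1, p.2, z) ∂ρ)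
      ((hc.comp (by fun_prop : Measurable fun p : (β × γ) × η => (p.1.2, p.2))).mul
        (hU.comp (by fun_prop : Measurable fun p : (β × γ) × η => (p.1.1, p.2))))).aemeasurable
  calc ∫⁻ g, ∫⁻ b, ∫⁻ x, c (g, x) * ∫⁻ z, u (b, x, z) ∂ρ ∂τ ∂μ ∂ν
      ≤ ∫⁻ g, C * (∫⁻ y, f (y, g) ∂σ) * N ∂ν := by
        refine lintegral_mono fun g => ?_
        rw [lintegral_lintegral_swap]
        swap
        · exact ((hc.comp (by fun_prop : Measurable fun p : β × η => (g, p.2))).mul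
            hU).aemeasurable
        calc ∫⁻ x, ∫⁻ b, c (g, x) * ∫⁻ z, u (b, x, z) ∂ρ ∂μ ∂τ
            = ∫⁻ x, c (g, x) * ∫⁻ b, ∫⁻ z, u (b, x, z) ∂ρ ∂μ ∂τ :=
              lintegral_congr fun x => lintegral_const_mul _
                (hU.comp (by fun_prop : Measurable fun b : β => (b, x)))
          _ ≤ ∫⁻ x, c (g, x) * N ∂τ := lintegral_mono fun x => by gcongr; exact hN x
          _ = (∫⁻ x, c (g, x) ∂τ) * N :=
              lintegral_mul_const _ (hc.comp measurable_prodMk_left)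
          _ = (∫⁻ y, f (y, g) * ∫⁻ x, k (y, x) ∂τ ∂σ) * N := by
              rw [hcdef, lintegral_lintegral_swap (by fun_prop)]
              congr 1
              exact lintegral_congr fun y => lintegral_const_mul (f (y, g))
                (by fun_prop : Measurable fun x => k (y, x))
          _ ≤ (∫⁻ y, f (y, g) * C ∂σ) * N := by
              gcongr with y
              exact hC y
          _ = C * (∫⁻ y, f (y, g) ∂σ) * N := by
              rw [lintegral_mul_const _ (by fun_prop), mul_comm C]
    _ = C * (∫⁻ p, f p ∂(σ.prod ν)) * N := by
        have hfg : Measurable fun g => ∫⁻ y, f (y, g) ∂σ := hf.lintegral_prod_left'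
        rw [lintegral_mul_const _ (by fun_prop), lintegral_const_mul _ hfg,
          lintegral_prod_symm' _ hf]

theorem measurable_lintegral_enorm {α Y : Type*} [TopologicalSpace α] [MeasurableSpace α]
    [OpensMeasurableSpace α] [SecondCountableTopology α]
    [TopologicalSpace Y] [MeasureSpace Y] [OpensMeasurableSpace Y]
    [SecondCountableTopology Y] [SFinite (volume : Measure Y)]
    (V : α → Y → ℝ) (hV : Continuous fun p : α × Y => V p.1 p.2) :
    Measurable fun x => ∫⁻ y, ‖V x y‖ₑ :=
  Measurable.lintegral_prod_right' (f := fun p : α × Y => ‖V p.1 p.2‖ₑ)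
    hV.measurable.enorm

theorem Bop_add (d q r MW MU : ℕ) (G : (Fin d → ℝ) → ℝ)
    (W : (Fin (q + 1) → Fin d → ℝ) → (Fin d → ℝ) → (Fin MW → Fin d → ℝ) → ℝ)
    (U : (Fin (r + 1) → Fin d → ℝ) → (Fin MU → Fin d → ℝ) → ℝ)
    (htiW : TransInvA d (q + 1) MW W) (htiU : TransInv d (r + 1) MU U)
    (x : Fin (q + r + 1) → Fin d → ℝ) (yW : Fin MW → Fin d → ℝ)
    (yU : Fin MU → Fin d → ℝ) (z : Fin d → ℝ) :
    Bop d q r MW MU G W U (fun j => x j + z) (fun i => yW i + z) (fun i => yU i + z) =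
      Bop d q r MW MU G W U x yW yU := by
  unfold Bop
  rw [← integral_add_right_eq_self _ z]
  congr 1
  funext xn
  rw [← integral_add_right_eq_self _ z]
  congr 1
  funext yy
  rw [htiW, add_sub_add_right_eq_sub, ← htiU _ yU z]
  congr 2
  funext j
  refine Fin.lastCases ?_ (fun j => ?_) j <;> simp

theorem Bop_congr_ae (d q r MW MU : ℕ) {G G' : (Fin d → ℝ) → ℝ} (h : G =ᵐ[volume] G')
    (W : (Fin (q + 1) → Fin d → ℝ) → (Fin d → ℝ) → (Fin MW → Fin d → ℝ) → ℝ)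
    (U : (Fin (r + 1) → Fin d → ℝ) → (Fin MU → Fin d → ℝ) → ℝ) :
    Bop d q r MW MU G W U = Bop d q r MW MU G' W U := by
  funext x yW yU
  unfold Bop
  congr 1
  funext xn
  refine integral_congr_ae ?_
  filter_upwards [(measurePreserving_sub_right volume xn).quasiMeasurePreserving.ae_eq_comp h]
    with yy hyy
  simp only [Function.comp_apply] at hyy
  rw [hyy]

theorem enorm_Bop_cons_le (d q r MW MU : ℕ) (G : (Fin d → ℝ) → ℝ)
    (W : (Fin (q + 1) → Fin d → ℝ) → (Fin d → ℝ) → (Fin MW → Fin d → ℝ) → ℝ)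
    (U : (Fin (r + 1) → Fin d → ℝ) → (Fin MU → Fin d → ℝ) → ℝ)
    (x1 : Fin d → ℝ) (xr : Fin (q + r) → Fin d → ℝ) (yW : Fin MW → Fin d → ℝ)
    (yU : Fin MU → Fin d → ℝ) :
    ‖Bop d q r MW MU G W U (Fin.cons x1 xr) yW yU‖ₑ ≤
      ∫⁻ xn : Fin d → ℝ, ∫⁻ yy : Fin d → ℝ,
        ‖W (Fin.cons x1 fun i => xr (Fin.castAdd r i)) yy yW‖ₑ * ‖G (yy - xn)‖ₑ *
          ‖U (Fin.snoc (fun j => xr (Fin.natAdd q j)) xn) yU‖ₑ := by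
  have hW : (fun j : Fin (q + 1) =>
      (Fin.cons x1 xr : Fin (q + r + 1) → Fin d → ℝ) ⟨j.1, by omega⟩) =
      Fin.cons x1 fun i => xr (Fin.castAdd r i) := by
    funext j
    refine Fin.cases rfl (fun j => rfl) j
  have hU : (fun j : Fin r =>
      (Fin.cons x1 xr : Fin (q + r + 1) → Fin d → ℝ) ⟨q + 1 + j.1, by omega⟩) =
      fun j => xr (Fin.natAdd q j) := by
    funext j
    have : (⟨q + 1 + j.1, by omega⟩ : Fin (q + r + 1)) = (Fin.natAdd q j).succ := by
      ext
      simp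
      omega
    rw [this, Fin.cons_succ]
  unfold Bop
  rw [hW, hU]
  refine (enorm_integral_le_lintegral_enorm _).trans (lintegral_mono fun xn => ?_)
  refine (enorm_integral_le_lintegral_enorm _).trans (lintegral_mono fun yy => ?_)
  rw [enorm_mul, enorm_mul]

/-- For a translation invariant, periodic-compatible `U`, the box integral of `[U]` with the last
`x` variable fixed is at most `‖U‖`. -/
theorem setLIntegral_snoc_le_VnormG (d r M : ℕ) (b : Fin M → Fin (r + 1))
    (U : (Fin (r + 1) → Fin d → ℝ) → (Fin M → Fin d → ℝ) → ℝ)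
    (hc : Continuous fun p :
      (Fin (r + 1) → Fin d → ℝ) × (Fin M → Fin d → ℝ) => U p.1 p.2)
    (hti : TransInv d (r + 1) M U) (hpc : PerCompat d (r + 1) M b U) (v : Fin d → ℝ) :
    ∫⁻ x in (Set.univ.pi fun _ : Fin r => box d),
      ∫⁻ y, ‖U (Fin.snoc x v : Fin (r + 1) → Fin d → ℝ) y‖ₑ ≤ VnormG d r U := by
  refine setLIntegral_snoc_le_iSup_cons r d (fun x => ∫⁻ y, ‖U x y‖ₑ)
    (measurable_lintegral_enorm U hc) (fun x z => ?_) (fun x k => ?_) v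
  · rw [← lintegral_add_right_eq_self _ (fun _ => z)]
    exact lintegral_congr fun y => congrArg _ (hti x y z)
  · rw [← lintegral_add_right_eq_self _ (fun i0 i => 2 * π * (k (b i0) i : ℝ))]
    exact lintegral_congr fun y => congrArg _ (hpc x y k)

theorem VnormG_Bop_le_of_measurable (d q r MW MU : ℕ)
    (G : (Fin d → ℝ) → ℝ) (hG : Measurable G) (bU : Fin MU → Fin (r + 1))
    (W : (Fin (q + 1) → Fin d → ℝ) → (Fin d → ℝ) → (Fin MW → Fin d → ℝ) → ℝ)
    (U : (Fin (r + 1) → Fin d → ℝ) → (Fin MU → Fin d → ℝ) → ℝ)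
    (hcW : Continuous fun p :
      (Fin (q + 1) → Fin d → ℝ) × (Fin d → ℝ) × (Fin MW → Fin d → ℝ) => W p.1 p.2.1 p.2.2)
    (hcU : Continuous fun p :
      (Fin (r + 1) → Fin d → ℝ) × (Fin MU → Fin d → ℝ) => U p.1 p.2)
    (htiU : TransInv d (r + 1) MU U) (hpcU : PerCompat d (r + 1) MU bU U) :
    VnormG d (q + r)
        (fun x (y : (Fin MW → Fin d → ℝ) × (Fin MU → Fin d → ℝ)) =>
          Bop d q r MW MU G W U x y.1 y.2) ≤
      (∫⁻ x : Fin d → ℝ, ‖G x‖ₑ) *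
        VnormG d q (fun x (p : (Fin d → ℝ) × (Fin MW → Fin d → ℝ)) => W x p.1 p.2) *
        VnormG d r U := by
  refine iSup_le fun x1 => ?_
  have hsnoc : Continuous fun p : (Fin r → Fin d → ℝ) × (Fin d → ℝ) =>
      (Fin.snoc p.1 p.2 : Fin (r + 1) → Fin d → ℝ) := by
    refine continuous_pi fun j => ?_
    refine Fin.lastCases ?_ (fun j => ?_) j <;> simp <;> fun_prop
  have hcons : Continuous fun a : Fin q → Fin d → ℝ =>
      (Fin.cons x1 a : Fin (q + 1) → Fin d → ℝ) := by
    refine continuous_pi fun j => ?_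
    refine Fin.cases ?_ (fun j => ?_) j <;> simp <;> fun_prop
  have hmW : Measurable fun p : (Fin q → Fin d → ℝ) × (Fin d → ℝ) × (Fin MW → Fin d → ℝ) =>
      ‖W (Fin.cons x1 p.1) p.2.1 p.2.2‖ₑ :=
    (hcW.comp (by fun_prop : Continuous fun p : (Fin q → Fin d → ℝ) × (Fin d → ℝ) ×
      (Fin MW → Fin d → ℝ) => ((Fin.cons x1 p.1 : Fin (q + 1) → Fin d → ℝ), p.2))).measurable.enorm
  have hmU : Measurable fun p : (Fin r → Fin d → ℝ) × (Fin d → ℝ) × (Fin MU → Fin d → ℝ) =>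
      ‖U (Fin.snoc p.1 p.2.1) p.2.2‖ₑ :=
    (hcU.comp ((hsnoc.comp (by fun_prop : Continuous fun p : (Fin r → Fin d → ℝ) ×
      (Fin d → ℝ) × (Fin MU → Fin d → ℝ) => (p.1, p.2.1))).prodMk
      (continuous_snd.comp continuous_snd))).measurable.enorm
  set Φ : (Fin q → Fin d → ℝ) × (Fin r → Fin d → ℝ) → ℝ≥0∞ := fun p =>
    ∫⁻ w : (Fin MW → Fin d → ℝ) × (Fin MU → Fin d → ℝ), ∫⁻ xn : Fin d → ℝ,
      ∫⁻ yy : Fin d → ℝ, ‖W (Fin.cons x1 p.1) yy w.1‖ₑ * ‖G (yy - xn)‖ₑ *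
        ‖U (Fin.snoc p.2 xn) w.2‖ₑ with hΦdef
  have hΦ : Measurable Φ := by
    refine Measurable.lintegral_prod_right (Measurable.lintegral_prod_right
      (Measurable.lintegral_prod_right ?_))
    have h1 := hmW.comp (by fun_prop : Measurable fun p : ((((Fin q → Fin d → ℝ) ×
      (Fin r → Fin d → ℝ)) × ((Fin MW → Fin d → ℝ) × (Fin MU → Fin d → ℝ))) × (Fin d → ℝ)) ×
      (Fin d → ℝ) => (p.1.1.1.1, p.2, p.1.1.2.1))
    have h2 := hmU.comp (by fun_prop : Measurable fun p : ((((Fin q → Fin d → ℝ) ×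
      (Fin r → Fin d → ℝ)) × ((Fin MW → Fin d → ℝ) × (Fin MU → Fin d → ℝ))) × (Fin d → ℝ)) ×
      (Fin d → ℝ) => (p.1.1.1.2, p.1.2, p.1.1.2.2))
    exact (h1.mul (hG.comp (measurable_snd.sub
      (measurable_snd.comp measurable_fst))).enorm).mul h2
  calc _ ≤ ∫⁻ x in (Set.univ.pi fun _ : Fin (q + r) => box d),
        Φ (fun i => x (Fin.castAdd r i), fun j => x (Fin.natAdd q j)) :=
        lintegral_mono fun x => lintegral_mono fun y =>
          enorm_Bop_cons_le d q r MW MU G W U x1 x y.1 y.2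
    _ = ∫⁻ a in (Set.univ.pi fun _ : Fin q => box d),
        ∫⁻ b in (Set.univ.pi fun _ : Fin r => box d), Φ (a, b) :=
        setLIntegral_pi_box_split q r d Φ hΦ
    _ ≤ ∫⁻ a in (Set.univ.pi fun _ : Fin q => box d), (∫⁻ x : Fin d → ℝ, ‖G x‖ₑ) *
          (∫⁻ p : (Fin d → ℝ) × (Fin MW → Fin d → ℝ), ‖W (Fin.cons x1 a) p.1 p.2‖ₑ) *
          VnormG d r U := by
        refine lintegral_mono fun a => ?_
        refine lintegral_kernel_comp_le _ volume volume volume volume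
          (fun p => ‖W (Fin.cons x1 a) p.1 p.2‖ₑ) (fun p => ‖G (p.1 - p.2)‖ₑ)
          (fun p => ‖U (Fin.snoc p.1 p.2.1) p.2.2‖ₑ)
          (hmW.comp measurable_prodMk_left) (by fun_prop) hmU _ _ (fun y => ?_) (fun x => ?_)
        · exact (lintegral_sub_left_eq_self (fun x => ‖G x‖ₑ) y).le
        · exact setLIntegral_snoc_le_VnormG d r MU bU U hcU htiU hpcU x
    _ = (∫⁻ x : Fin d → ℝ, ‖G x‖ₑ) *
          (∫⁻ a in (Set.univ.pi fun _ : Fin q => box d),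
            ∫⁻ p : (Fin d → ℝ) × (Fin MW → Fin d → ℝ), ‖W (Fin.cons x1 a) p.1 p.2‖ₑ) *
          VnormG d r U := by
        have hm := hmW.lintegral_prod_right' (ν := volume)
        rw [lintegral_mul_const _ (hm.const_mul _), lintegral_const_mul _ hm]
    _ ≤ _ := by
        gcongr
        exact le_iSup (fun x1 : Fin d → ℝ => ∫⁻ a in (Set.univ.pi fun _ : Fin q => box d),
          ∫⁻ p : (Fin d → ℝ) × (Fin MW → Fin d → ℝ), ‖W (Fin.cons x1 a) p.1 p.2‖ₑ) x1

/-- if `G ∈ L¹` and `W`, `U` are continuous, translationally invariant,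
periodic-compatible with finite norms, then `𝐁(G,W,U)` is translationally invariant and
`‖𝐁(G,W,U)‖_{𝒱^𝗆} ≤ ‖G‖_{L¹} ‖W‖_{𝒱^𝗆̂} ‖U‖_{𝒱^𝗆̌}`. -/
theorem stmt2 (d q r MW MU : ℕ) (hd : 1 ≤ d)
    (G : (Fin d → ℝ) → ℝ) (hG : Integrable G)
    (bW : Fin MW → Fin (q + 1)) (bU : Fin MU → Fin (r + 1))
    (W : (Fin (q + 1) → Fin d → ℝ) → (Fin d → ℝ) → (Fin MW → Fin d → ℝ) → ℝ)
    (U : (Fin (r + 1) → Fin d → ℝ) → (Fin MU → Fin d → ℝ) → ℝ)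
    (hcW : Continuous fun p :
      (Fin (q + 1) → Fin d → ℝ) × (Fin d → ℝ) × (Fin MW → Fin d → ℝ) => W p.1 p.2.1 p.2.2)
    (hcU : Continuous fun p :
      (Fin (r + 1) → Fin d → ℝ) × (Fin MU → Fin d → ℝ) => U p.1 p.2)
    (htiW : TransInvA d (q + 1) MW W) (htiU : TransInv d (r + 1) MU U)
    (hpcW : PerCompatA d (q + 1) MW bW W (Nat.succ_pos _))
    (hpcU : PerCompat d (r + 1) MU bU U)
    (hfW : VnormG d q
      (fun x (p : (Fin d → ℝ) × (Fin MW → Fin d → ℝ)) => W x p.1 p.2) < ⊤)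
    (hfU : VnormG d r U < ⊤) :
    (∀ (x : Fin (q + r + 1) → Fin d → ℝ) (yW : Fin MW → Fin d → ℝ)
        (yU : Fin MU → Fin d → ℝ) (z : Fin d → ℝ),
      Bop d q r MW MU G W U (fun j => x j + z) (fun i => yW i + z) (fun i => yU i + z) =
        Bop d q r MW MU G W U x yW yU) ∧
    VnormG d (q + r)
        (fun x (y : (Fin MW → Fin d → ℝ) × (Fin MU → Fin d → ℝ)) =>
          Bop d q r MW MU G W U x y.1 y.2) ≤
      (∫⁻ x : Fin d → ℝ, (‖G x‖₊ : ℝ≥0∞)) *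
        VnormG d q (fun x (p : (Fin d → ℝ) × (Fin MW → Fin d → ℝ)) => W x p.1 p.2) *
        VnormG d r U := by
  refine ⟨Bop_add d q r MW MU G W U htiW htiU, ?_⟩
  have hae := hG.aestronglyMeasurable.ae_eq_mk
  rw [Bop_congr_ae d q r MW MU hae W U]
  have hnorm : ∫⁻ x : Fin d → ℝ, (‖G x‖₊ : ℝ≥0∞) =
      ∫⁻ x, ‖hG.aestronglyMeasurable.mk G x‖ₑ :=
    lintegral_congr_ae (hae.mono fun x hx => congrArg (fun t : ℝ => ‖t‖ₑ) hx)
  rw [hnorm]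
  exact VnormG_Bop_le_of_measurable d q r MW MU _
    hG.aestronglyMeasurable.stronglyMeasurable_mk.measurable bU W U hcW hcU htiU hpcU
end

section
/- For all μ, η > 0 set c := (η/μ)^{2/σ} = [η/μ]^2. Then the identity K_μ(x) = c K_η(x) + (1−c)(K_μ ∗ K_η)(x) holds for almost every x ∈ ℝ^d; equivalently, the signed measure K_{μ,η} := c δ_0 + (1−c) K_μ(x)dx satisfies K_{μ,η} ∗ K_η = K_μ (as finite measures on ℝ^d). Moreover, the total variation norm of K_{μ,η} equals max(1, 2(η/μ)^{2/σ} − 1); in particular it equals 1 whenever η ≤ μ. -/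
open MeasureTheory ENNReal Real

/-- The kernel `K_μ` as a real-valued function (subordination formula). -/
noncomputable def KkerR (d : ℕ) (σ μ : ℝ) (x : Fin d → ℝ) : ℝ :=
  ∫ t in Set.Ioi (0 : ℝ),
    Real.exp (-t) * (4 * π * t * μ ^ ((2 : ℝ) / σ)) ^ (-(d : ℝ) / 2) *
      Real.exp (-(∑ i, x i ^ 2) / (4 * t * μ ^ ((2 : ℝ) / σ)))

/-- The kernel `K_μ` (density, valued in `[0,∞]`). -/
noncomputable def Kker (d : ℕ) (σ μ : ℝ) (x : Fin d → ℝ) : ℝ≥0∞ :=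
  ∫⁻ t in Set.Ioi (0 : ℝ), ENNReal.ofReal
    (Real.exp (-t) * (4 * π * t * μ ^ ((2 : ℝ) / σ)) ^ (-(d : ℝ) / 2) *
      Real.exp (-(∑ i, x i ^ 2) / (4 * t * μ ^ ((2 : ℝ) / σ))))

/-- The kernel `K_μ` as a measure on `ℝ^d`. -/
noncomputable def Kmeas (d : ℕ) (σ μ : ℝ) : Measure (Fin d → ℝ) :=
  volume.withDensity (Kker d σ μ)

/-- The heat kernel on `ℝ^d` at time `s`. -/
noncomputable def heatKernel (d : ℕ) (s : ℝ) (x : Fin d → ℝ) : ℝ :=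
  (4 * π * s) ^ (-(d : ℝ) / 2) * Real.exp (-(∑ i, x i ^ 2) / (4 * s))

lemma heatKernel_nonneg (d : ℕ) {s : ℝ} (hs : 0 < s) (x : Fin d → ℝ) : 0 ≤ heatKernel d s x := by
  unfold heatKernel; positivity

lemma heatKernel_eq_prod (d : ℕ) {s : ℝ} (hs : 0 < s) (x : Fin d → ℝ) :
    heatKernel d s x =
      ∏ i, ProbabilityTheory.gaussianPDFReal 0 (Real.toNNReal (2 * s)) (x i) := by
  have h2 : (0 : ℝ) ≤ 2 * s := by positivity
  have h4 : (0 : ℝ) < 4 * π * s := by positivity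
  simp only [ProbabilityTheory.gaussianPDFReal, Real.coe_toNNReal _ h2, Finset.prod_mul_distrib,
    Finset.prod_const, Finset.card_univ, Fintype.card_fin, ← Real.exp_sum, heatKernel]
  congr 1
  · rw [show 2 * π * (2 * s) = 4 * π * s by ring, Real.sqrt_eq_rpow, ← Real.rpow_neg h4.le,
      ← Real.rpow_natCast, ← Real.rpow_mul h4.le]
    congr 1; ring
  · rw [neg_div, Finset.sum_div, ← Finset.sum_neg_distrib]
    congr 1
    refine Finset.sum_congr rfl fun i _ => ?_
    rw [sub_zero, neg_div, show 2 * (2 * s) = 4 * s by ring]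

lemma gaussianPDFReal_mul_sub {v w : NNReal} (hv : v ≠ 0) (hw : w ≠ 0) (x z : ℝ) :
    ProbabilityTheory.gaussianPDFReal 0 v z * ProbabilityTheory.gaussianPDFReal 0 w (x - z) =
      ProbabilityTheory.gaussianPDFReal 0 (v + w) x *
        ProbabilityTheory.gaussianPDFReal (x * v / (v + w)) (v * w / (v + w)) z := by
  have hv' : (0 : ℝ) < v := by positivity
  have hw' : (0 : ℝ) < w := by positivity
  simp only [ProbabilityTheory.gaussianPDFReal]
  rw [mul_mul_mul_comm (√(2 * π * v))⁻¹, mul_mul_mul_comm (√(2 * π * ↑(v + w)))⁻¹,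
    ← mul_inv, ← mul_inv, ← Real.sqrt_mul (by positivity),
    ← Real.sqrt_mul (by positivity), ← Real.exp_add, ← Real.exp_add]
  push_cast
  congr 1
  · congr 2
    field_simp
  · congr 1
    field_simp
    ring

lemma integral_gaussianPDFReal_mul_sub {v w : NNReal} (hv : v ≠ 0) (hw : w ≠ 0) (x : ℝ) :
    ∫ z, ProbabilityTheory.gaussianPDFReal 0 v z * ProbabilityTheory.gaussianPDFReal 0 w (x - z) =
      ProbabilityTheory.gaussianPDFReal 0 (v + w) x := by
  simp_rw [gaussianPDFReal_mul_sub hv hw]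
  rw [integral_const_mul, ProbabilityTheory.integral_gaussianPDFReal_eq_one, mul_one]
  positivity

lemma integrable_gaussianPDFReal_mul_sub {v w : NNReal} (hv : v ≠ 0) (hw : w ≠ 0) (x : ℝ) :
    Integrable fun z => ProbabilityTheory.gaussianPDFReal 0 v z *
      ProbabilityTheory.gaussianPDFReal 0 w (x - z) := by
  simp_rw [gaussianPDFReal_mul_sub hv hw]
  exact (ProbabilityTheory.integrable_gaussianPDFReal _ _).const_mul _

lemma lintegral_heatKernel (d : ℕ) {s : ℝ} (hs : 0 < s) :
    ∫⁻ x, ENNReal.ofReal (heatKernel d s x) = 1 := by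
  have hv : Real.toNNReal (2 * s) ≠ 0 := by simpa using hs
  rw [← ofReal_integral_eq_lintegral_ofReal]
  · simp_rw [heatKernel_eq_prod d hs]
    rw [integral_fintype_prod_volume_eq_prod
      (fun _ => ProbabilityTheory.gaussianPDFReal 0 (Real.toNNReal (2 * s)))]
    simp [ProbabilityTheory.integral_gaussianPDFReal_eq_one _ hv]
  · rw [funext (heatKernel_eq_prod d hs)]
    exact Integrable.fintype_prod
      fun _ => ProbabilityTheory.integrable_gaussianPDFReal 0 (Real.toNNReal (2 * s))
  · exact .of_forall (heatKernel_nonneg d hs)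

lemma lintegral_heatKernel_mul_sub (d : ℕ) {s r : ℝ} (hs : 0 < s) (hr : 0 < r) (x : Fin d → ℝ) :
    ∫⁻ z, ENNReal.ofReal (heatKernel d s z) * ENNReal.ofReal (heatKernel d r (x - z)) =
      ENNReal.ofReal (heatKernel d (s + r) x) := by
  have hv : Real.toNNReal (2 * s) ≠ 0 := by simpa using hs
  have hw : Real.toNNReal (2 * r) ≠ 0 := by simpa using hr
  rw [lintegral_congr fun z => (ENNReal.ofReal_mul (heatKernel_nonneg d hs z)).symm]
  rw [← ofReal_integral_eq_lintegral_ofReal]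
  · rw [heatKernel_eq_prod d (add_pos hs hr)]
    simp_rw [heatKernel_eq_prod d hs, heatKernel_eq_prod d hr, ← Finset.prod_mul_distrib,
      Pi.sub_apply]
    rw [integral_fintype_prod_volume_eq_prod
      (fun i z => ProbabilityTheory.gaussianPDFReal 0 (Real.toNNReal (2 * s)) z *
        ProbabilityTheory.gaussianPDFReal 0 (Real.toNNReal (2 * r)) (x i - z))]
    simp_rw [integral_gaussianPDFReal_mul_sub hv hw]
    rw [mul_add, Real.toNNReal_add (by positivity) (by positivity)]
  · simp_rw [heatKernel_eq_prod d hs, heatKernel_eq_prod d hr, ← Finset.prod_mul_distrib,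
      Pi.sub_apply]
    exact Integrable.fintype_prod (f := fun i z =>
        ProbabilityTheory.gaussianPDFReal 0 (Real.toNNReal (2 * s)) z *
        ProbabilityTheory.gaussianPDFReal 0 (Real.toNNReal (2 * r)) (x i - z))
      fun i => integrable_gaussianPDFReal_mul_sub hv hw (x i)
  · exact .of_forall fun z => mul_nonneg (heatKernel_nonneg d hs _) (heatKernel_nonneg d hr _)

lemma lintegral_Ioi_comp_mul_add {a : ℝ} (ha : 0 < a) (k : ℝ) (F : ℝ → ℝ≥0∞) :
    ∫⁻ t in Set.Ioi 0, F (t * a + k) = ENNReal.ofReal a⁻¹ * ∫⁻ u in Set.Ioi k, F u := by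
  have himg : Set.image (fun t : ℝ => t * a + k) (Set.Ioi 0) = Set.Ioi k := by
    ext u
    simp only [Set.mem_image, Set.mem_Ioi]
    constructor
    · rintro ⟨t, ht, rfl⟩
      nlinarith [mul_pos ht ha]
    · intro hu
      exact ⟨(u - k) / a, div_pos (by linarith) ha, by field_simp; ring⟩
  have hd : ∀ t ∈ Set.Ioi (0 : ℝ),
      HasDerivWithinAt (fun t : ℝ => t * a + k) a (Set.Ioi 0) t := fun t _ => by
    simpa using (((hasDerivAt_id t).mul_const a).add_const k).hasDerivWithinAt
  have hinj : Set.InjOn (fun t : ℝ => t * a + k) (Set.Ioi 0) := fun t _ r _ h => by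
    simpa [ha.ne'] using h
  rw [← himg, lintegral_image_eq_lintegral_abs_deriv_mul measurableSet_Ioi hd hinj, abs_of_pos ha,
    lintegral_const_mul' _ _ ENNReal.ofReal_ne_top, ← mul_assoc,
    ← ENNReal.ofReal_mul (by positivity), inv_mul_cancel₀ ha.ne', ENNReal.ofReal_one, one_mul]

lemma lintegral_Ioo_exp {a b u : ℝ} (hb : 0 < b) (hab : b < a) (hu : 0 < u) :
    ∫⁻ r in Set.Ioo 0 (u / b), ENNReal.ofReal (Real.exp (-((u - r * b) / a)) * Real.exp (-r)) =
      ENNReal.ofReal (a / (a - b) * (Real.exp (-(u / a)) - Real.exp (-(u / b)))) := by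
  have ha : 0 < a := hb.trans hab
  have hab' : 0 < a - b := sub_pos.2 hab
  have hcont : Continuous fun r : ℝ => Real.exp (-((u - r * b) / a)) * Real.exp (-r) := by fun_prop
  rw [restrict_Ioo_eq_restrict_Ioc, ← ofReal_integral_eq_lintegral_ofReal
    (hcont.integrableOn_Ioc) (.of_forall fun r => by positivity),
    ← intervalIntegral.integral_of_le (by positivity)]
  congr 1
  rw [intervalIntegral.integral_eq_sub_of_hasDerivAt
    (f := fun r => -(a / (a - b)) * (Real.exp (-((u - r * b) / a)) * Real.exp (-r)))]
  · rw [← Real.exp_add, ← Real.exp_add]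
    have h1 : -((u - u / b * b) / a) + -(u / b) = -(u / b) := by field_simp; ring
    have h2 : -((u - 0 * b) / a) + -0 = -(u / a) := by ring
    rw [h1, h2]; ring
  · intro r _
    have h1 : HasDerivAt (fun r : ℝ => -((u - r * b) / a)) (b / a) r :=
      ((((hasDerivAt_id r).mul_const b).const_sub u).div_const a).neg.congr_deriv (by ring)
    have h2 : HasDerivAt (fun r : ℝ => -r) (-1) r := (hasDerivAt_id r).neg
    refine ((h1.exp.mul h2.exp).const_mul (-(a / (a - b)))).congr_deriv ?_
    field_simp
    ring
  · exact hcont.intervalIntegrable _ _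

lemma lintegral_Ioi_exp_mul_resolvent {a b : ℝ} (hb : 0 < b) (hab : b < a) {G : ℝ → ℝ≥0∞}
    (hG : Measurable G) :
    ENNReal.ofReal a * ∫⁻ t in Set.Ioi 0, ENNReal.ofReal (Real.exp (-t)) * G (t * a) =
      ENNReal.ofReal b * (∫⁻ t in Set.Ioi 0, ENNReal.ofReal (Real.exp (-t)) * G (t * b)) +
      ENNReal.ofReal (a - b) * ∫⁻ r in Set.Ioi 0, ∫⁻ t in Set.Ioi 0,
        ENNReal.ofReal (Real.exp (-t)) * ENNReal.ofReal (Real.exp (-r)) * G (t * a + r * b) := by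
  have ha : 0 < a := hb.trans hab
  have hab' : 0 < a - b := sub_pos.2 hab
  have single : ∀ a : ℝ, 0 < a →
      ENNReal.ofReal a * ∫⁻ t in Set.Ioi 0, ENNReal.ofReal (Real.exp (-t)) * G (t * a) =
        ∫⁻ u in Set.Ioi 0, ENNReal.ofReal (Real.exp (-(u / a))) * G u := fun a ha => by
    have := lintegral_Ioi_comp_mul_add ha 0 fun u => ENNReal.ofReal (Real.exp (-(u / a))) * G u
    simp only [add_zero, mul_div_cancel_right₀ _ ha.ne'] at this
    rw [this, ← mul_assoc, ← ENNReal.ofReal_mul ha.le, mul_inv_cancel₀ ha.ne', ENNReal.ofReal_one,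
      one_mul]
  have inner : ∀ r ∈ Set.Ioi (0 : ℝ), ∫⁻ t in Set.Ioi 0,
      ENNReal.ofReal (Real.exp (-t)) * ENNReal.ofReal (Real.exp (-r)) * G (t * a + r * b) =
      ENNReal.ofReal a⁻¹ * ∫⁻ u in Set.Ioi 0, (Set.Ioi (r * b)).indicator
        (fun u => ENNReal.ofReal (Real.exp (-((u - r * b) / a)) * Real.exp (-r)) * G u) u := by
    intro r hr
    have hrb : 0 < r * b := mul_pos hr hb
    have := lintegral_Ioi_comp_mul_add ha (r * b) fun u =>
      ENNReal.ofReal (Real.exp (-((u - r * b) / a)) * Real.exp (-r)) * G u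
    rw [lintegral_indicator measurableSet_Ioi, Measure.restrict_restrict measurableSet_Ioi,
      Set.inter_eq_left.2 (Set.Ioi_subset_Ioi hrb.le), ← this]
    refine lintegral_congr fun t => ?_
    rw [add_sub_cancel_right, mul_div_cancel_right₀ _ ha.ne',
      ENNReal.ofReal_mul (Real.exp_nonneg _)]
  have outer : ∀ u ∈ Set.Ioi (0 : ℝ), ∫⁻ r in Set.Ioi 0, (Set.Ioi (r * b)).indicator
        (fun u => ENNReal.ofReal (Real.exp (-((u - r * b) / a)) * Real.exp (-r)) * G u) u =
      ENNReal.ofReal (a / (a - b) * (Real.exp (-(u / a)) - Real.exp (-(u / b)))) * G u := by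
    intro u hu
    rw [← lintegral_Ioo_exp hb hab hu, ← lintegral_mul_const _ (by fun_prop),
      ← Set.Iio_inter_Ioi, ← Measure.restrict_restrict measurableSet_Iio,
      ← lintegral_indicator measurableSet_Iio]
    refine lintegral_congr fun r => ?_
    simp only [Set.indicator, Set.mem_Ioi, Set.mem_Iio, lt_div_iff₀ hb]
  have hmeas : Measurable (Function.uncurry fun r u : ℝ => (Set.Ioi (r * b)).indicator
        (fun u => ENNReal.ofReal (Real.exp (-((u - r * b) / a)) * Real.exp (-r)) * G u) u) := by
    have : Measurable fun p : ℝ × ℝ =>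
      ENNReal.ofReal (Real.exp (-((p.2 - p.1 * b) / a)) * Real.exp (-p.1)) * G p.2 := by fun_prop
    exact this.indicator (measurableSet_lt (by fun_prop : Measurable fun p : ℝ × ℝ => p.1 * b)
      measurable_snd)
  rw [single a ha, single b hb, setLIntegral_congr_fun measurableSet_Ioi inner,
    lintegral_const_mul' _ _ ENNReal.ofReal_ne_top, lintegral_lintegral_swap hmeas.aemeasurable,
    setLIntegral_congr_fun measurableSet_Ioi outer, ← mul_assoc, ← ENNReal.ofReal_mul hab'.le,
    ← lintegral_const_mul' _ _ ENNReal.ofReal_ne_top, ← lintegral_add_left (by fun_prop)]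
  refine setLIntegral_congr_fun measurableSet_Ioi fun u hu => ?_
  have hle : Real.exp (-(u / b)) ≤ Real.exp (-(u / a)) := by
    have hu : 0 < u := hu
    gcongr
  rw [← mul_assoc, ← ENNReal.ofReal_mul (by positivity), ← add_mul,
    ← ENNReal.ofReal_add (Real.exp_nonneg _)
      (mul_nonneg (by positivity) (mul_nonneg (by positivity) (sub_nonneg.2 hle)))]
  congr 2
  field_simp
  ring

section kernel

variable (d : ℕ) (σ μ : ℝ)

lemma Kker_eq_lintegral_heatKernel (x : Fin d → ℝ) :
    Kker d σ μ x = ∫⁻ t in Set.Ioi (0 : ℝ), ENNReal.ofReal (Real.exp (-t)) *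
      ENNReal.ofReal (heatKernel d (t * μ ^ ((2 : ℝ) / σ)) x) := by
  refine lintegral_congr fun t => ?_
  rw [← ENNReal.ofReal_mul (Real.exp_nonneg _), heatKernel]
  simp only [mul_assoc]

lemma measurable_Kker : Measurable (Kker d σ μ) := by
  have : Measurable fun p : (Fin d → ℝ) × ℝ => ENNReal.ofReal
      (Real.exp (-p.2) * (4 * π * p.2 * μ ^ ((2 : ℝ) / σ)) ^ (-(d : ℝ) / 2) *
        Real.exp (-(∑ i, p.1 i ^ 2) / (4 * p.2 * μ ^ ((2 : ℝ) / σ)))) := by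
    fun_prop
  exact this.lintegral_prod_right'

variable {μ}

lemma KkerR_eq_toReal (hμ : 0 < μ) (x : Fin d → ℝ) : KkerR d σ μ x = (Kker d σ μ x).toReal := by
  refine integral_eq_lintegral_of_nonneg_ae ?_ (Measurable.aestronglyMeasurable (by fun_prop))
  filter_upwards [ae_restrict_mem measurableSet_Ioi] with t ht
  have ht : 0 < t := ht
  simp only [Pi.zero_apply]
  positivity

lemma lintegral_Kker (hμ : 0 < μ) : ∫⁻ x, Kker d σ μ x = 1 := by
  have ha : 0 < μ ^ ((2 : ℝ) / σ) := by positivity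
  simp_rw [Kker_eq_lintegral_heatKernel]
  rw [lintegral_lintegral_swap (Measurable.aemeasurable (by
    unfold Function.uncurry heatKernel; fun_prop))]
  have : ∀ t ∈ Set.Ioi (0 : ℝ), ∫⁻ x, ENNReal.ofReal (Real.exp (-t)) *
      ENNReal.ofReal (heatKernel d (t * μ ^ ((2 : ℝ) / σ)) x) = ENNReal.ofReal (Real.exp (-t)) :=
    fun t ht => by
      rw [lintegral_const_mul' _ _ ENNReal.ofReal_ne_top,
        lintegral_heatKernel d (mul_pos ht ha), mul_one]
  rw [setLIntegral_congr_fun measurableSet_Ioi this, ← ofReal_integral_eq_lintegral_ofReal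
    (integrableOn_exp_neg_Ioi 0) (.of_forall fun t => Real.exp_nonneg _),
    integral_exp_neg_Ioi_zero, ENNReal.ofReal_one]

lemma Kker_ae_ne_top (hμ : 0 < μ) : ∀ᵐ x, Kker d σ μ x ≠ ∞ :=
  (ae_lt_top (measurable_Kker d σ μ) (by simp [lintegral_Kker d σ hμ])).mono fun _ h => h.ne

variable {η : ℝ}

lemma lintegral_Kker_mul_sub (hμ : 0 < μ) (hη : 0 < η) (x : Fin d → ℝ) :
    ∫⁻ z, Kker d σ μ z * Kker d σ η (x - z) =
      ∫⁻ r in Set.Ioi 0, ∫⁻ t in Set.Ioi 0,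
        ENNReal.ofReal (Real.exp (-t)) * ENNReal.ofReal (Real.exp (-r)) *
          ENNReal.ofReal (heatKernel d (t * μ ^ ((2 : ℝ) / σ) + r * η ^ ((2 : ℝ) / σ)) x) := by
  have ha : 0 < μ ^ ((2 : ℝ) / σ) := by positivity
  have hb : 0 < η ^ ((2 : ℝ) / σ) := by positivity
  set a := μ ^ ((2 : ℝ) / σ)
  set b := η ^ ((2 : ℝ) / σ)
  have hprod : ∀ z, Kker d σ μ z * Kker d σ η (x - z) =
      ∫⁻ r in Set.Ioi 0, ∫⁻ t in Set.Ioi 0,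
        (ENNReal.ofReal (Real.exp (-t)) * ENNReal.ofReal (heatKernel d (t * a) z)) *
        (ENNReal.ofReal (Real.exp (-r)) * ENNReal.ofReal (heatKernel d (r * b) (x - z))) := by
    intro z
    rw [Kker_eq_lintegral_heatKernel, Kker_eq_lintegral_heatKernel,
      ← lintegral_const_mul _ (by unfold heatKernel; fun_prop)]
    refine lintegral_congr fun r => ?_
    rw [lintegral_mul_const _ (by unfold heatKernel; fun_prop)]
  simp_rw [hprod]
  rw [lintegral_lintegral_swap (Measurable.aemeasurable ?_)]
  · refine setLIntegral_congr_fun measurableSet_Ioi fun r hr => ?_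
    rw [lintegral_lintegral_swap (Measurable.aemeasurable (by
      unfold Function.uncurry heatKernel; fun_prop))]
    refine setLIntegral_congr_fun measurableSet_Ioi fun t ht => ?_
    rw [lintegral_congr fun z => mul_mul_mul_comm _ _ _ _,
      lintegral_const_mul _ (by unfold heatKernel; fun_prop),
      lintegral_heatKernel_mul_sub d (mul_pos ht ha) (mul_pos hr hb)]
  · have : Measurable fun p : ((Fin d → ℝ) × ℝ) × ℝ =>
        (ENNReal.ofReal (Real.exp (-p.2)) * ENNReal.ofReal (heatKernel d (p.2 * a) p.1.1)) *
        (ENNReal.ofReal (Real.exp (-p.1.2)) *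
          ENNReal.ofReal (heatKernel d (p.1.2 * b) (x - p.1.1))) := by
      unfold heatKernel
      fun_prop
    exact this.lintegral_prod_right'

lemma Kker_resolvent (hσ : 0 < σ) (hη : 0 < η) (h : η < μ) (x : Fin d → ℝ) :
    ENNReal.ofReal (μ ^ ((2 : ℝ) / σ)) * Kker d σ μ x =
      ENNReal.ofReal (η ^ ((2 : ℝ) / σ)) * Kker d σ η x +
      ENNReal.ofReal (μ ^ ((2 : ℝ) / σ) - η ^ ((2 : ℝ) / σ)) *
        ∫⁻ z, Kker d σ μ z * Kker d σ η (x - z) := by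
  rw [lintegral_Kker_mul_sub d σ (hη.trans h) hη, Kker_eq_lintegral_heatKernel,
    Kker_eq_lintegral_heatKernel]
  exact lintegral_Ioi_exp_mul_resolvent (G := fun s => ENNReal.ofReal (heatKernel d s x))
    (by positivity) (Real.rpow_lt_rpow hη.le h (by positivity)) (by unfold heatKernel; fun_prop)

lemma lintegral_Kker_mul_sub_comm (x : Fin d → ℝ) :
    ∫⁻ z, Kker d σ μ z * Kker d σ η (x - z) = ∫⁻ z, Kker d σ η z * Kker d σ μ (x - z) := by
  rw [← lintegral_sub_left_eq_self _ x]
  simp [mul_comm]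

lemma integral_KkerR_mul_sub (hμ : 0 < μ) (hη : 0 < η) (x : Fin d → ℝ) :
    ∫ z, KkerR d σ μ z * KkerR d σ η (x - z) =
      (∫⁻ z, Kker d σ μ z * Kker d σ η (x - z)).toReal := by
  have hm : Measurable fun z => KkerR d σ μ z * KkerR d σ η (x - z) := by
    have h1 := measurable_Kker d σ μ
    have h2 := measurable_Kker d σ η
    simp_rw [KkerR_eq_toReal d σ hμ, KkerR_eq_toReal d σ hη]
    fun_prop
  rw [integral_eq_lintegral_of_nonneg_ae (.of_forall fun z => ?_) hm.aestronglyMeasurable]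
  · congr 1
    refine lintegral_congr_ae ?_
    have h2 : ∀ᵐ z, Kker d σ η (x - z) ≠ ∞ :=
      (quasiMeasurePreserving_sub_left volume x).ae (Kker_ae_ne_top d σ hη)
    filter_upwards [Kker_ae_ne_top d σ hμ, h2] with z hz1 hz2
    rw [KkerR_eq_toReal d σ hμ, KkerR_eq_toReal d σ hη, ← ENNReal.toReal_mul,
      ENNReal.ofReal_toReal (ENNReal.mul_ne_top hz1 hz2)]
  · simp only [KkerR_eq_toReal d σ hμ, KkerR_eq_toReal d σ hη, Pi.zero_apply]
    positivity

lemma KkerR_resolvent (hσ : 0 < σ) (hη : 0 < η) (h : η < μ) : ∀ᵐ x,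
    μ ^ ((2 : ℝ) / σ) * KkerR d σ μ x =
      η ^ ((2 : ℝ) / σ) * KkerR d σ η x +
      (μ ^ ((2 : ℝ) / σ) - η ^ ((2 : ℝ) / σ)) * ∫ z, KkerR d σ μ z * KkerR d σ η (x - z) := by
  have hμ : 0 < μ := hη.trans h
  have hsub : 0 < μ ^ ((2 : ℝ) / σ) - η ^ ((2 : ℝ) / σ) :=
    sub_pos.2 (Real.rpow_lt_rpow hη.le h (by positivity))
  filter_upwards [Kker_ae_ne_top d σ hμ] with x hx
  have key := Kker_resolvent d σ hσ hη h x
  have hfin := ENNReal.mul_ne_top (ENNReal.ofReal_ne_top (r := μ ^ ((2 : ℝ) / σ))) hx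
  rw [key, ENNReal.add_ne_top] at hfin
  have := congrArg ENNReal.toReal key
  rw [ENNReal.toReal_add hfin.1 hfin.2, ENNReal.toReal_mul, ENNReal.toReal_mul, ENNReal.toReal_mul,
    ENNReal.toReal_ofReal (by positivity), ENNReal.toReal_ofReal (by positivity),
    ENNReal.toReal_ofReal hsub.le] at this
  rw [integral_KkerR_mul_sub d σ hμ hη, KkerR_eq_toReal d σ hμ, KkerR_eq_toReal d σ hη, this]

lemma integral_KkerR_mul_sub_comm (hμ : 0 < μ) (hη : 0 < η) (x : Fin d → ℝ) :
    ∫ z, KkerR d σ μ z * KkerR d σ η (x - z) = ∫ z, KkerR d σ η z * KkerR d σ μ (x - z) := by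
  rw [integral_KkerR_mul_sub d σ hμ hη, integral_KkerR_mul_sub d σ hη hμ,
    lintegral_Kker_mul_sub_comm]

lemma KkerR_eq_add_convolution (hσ : 0 < σ) (hμ : 0 < μ) (hη : 0 < η) : ∀ᵐ x,
    KkerR d σ μ x = (η / μ) ^ ((2 : ℝ) / σ) * KkerR d σ η x +
      (1 - (η / μ) ^ ((2 : ℝ) / σ)) * ∫ z, KkerR d σ μ z * KkerR d σ η (x - z) := by
  have ha : 0 < μ ^ ((2 : ℝ) / σ) := by positivity
  rw [Real.div_rpow hη.le hμ.le]
  rcases lt_trichotomy η μ with h | rfl | h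
  · filter_upwards [KkerR_resolvent d σ hσ hη h] with x hx
    field_simp
    linarith
  · simp [ha.ne']
  · filter_upwards [KkerR_resolvent d σ hσ hμ h] with x hx
    rw [integral_KkerR_mul_sub_comm d σ hμ hη]
    field_simp
    linarith

end kernel

/-- The total variation of a difference of mutually singular finite measures is their sum. -/
lemma totalVariation_sub_of_mutuallySingular {α : Type*} [MeasurableSpace α] {ν ρ : Measure α}
    [IsFiniteMeasure ν] [IsFiniteMeasure ρ] (h : ν ⟂ₘ ρ) :
    (ν.toSignedMeasure - ρ.toSignedMeasure).totalVariation = ν + ρ := by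
  have : (ν.toSignedMeasure - ρ.toSignedMeasure).toJordanDecomposition = ⟨ν, ρ, h⟩ :=
    SignedMeasure.toJordanDecomposition_eq rfl
  rw [SignedMeasure.totalVariation, this]

lemma totalVariation_smul_dirac_add_smul {α : Type*} [MeasurableSpace α]
    [MeasurableSingletonClass α] (a : α) {ν : Measure α} [IsProbabilityMeasure ν]
    (ha : ν {a} = 0) {c : ℝ} (hc : 0 ≤ c) :
    (c • (Measure.dirac a).toSignedMeasure + (1 - c) • ν.toSignedMeasure).totalVariation Set.univ =
      ENNReal.ofReal (max 1 (2 * c - 1)) := by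
  rcases le_total c 1 with h | h
  · have heq : c • (Measure.dirac a).toSignedMeasure + (1 - c) • ν.toSignedMeasure =
        (c.toNNReal • Measure.dirac a + (1 - c).toNNReal • ν).toSignedMeasure -
          (0 : Measure α).toSignedMeasure := by
      rw [Measure.toSignedMeasure_zero, sub_zero, Measure.toSignedMeasure_add,
        Measure.toSignedMeasure_smul, Measure.toSignedMeasure_smul, NNReal.smul_def,
        NNReal.smul_def, Real.coe_toNNReal _ hc, Real.coe_toNNReal _ (sub_nonneg.2 h)]
    rw [heq, totalVariation_sub_of_mutuallySingular Measure.MutuallySingular.zero_right,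
      max_eq_left (by linarith)]
    simp only [Measure.add_apply, Measure.smul_apply, measure_univ, ENNReal.smul_def, smul_eq_mul,
      mul_one, ENNReal.ofNNReal_toNNReal, add_zero]
    rw [← ENNReal.ofReal_add hc (sub_nonneg.2 h), add_sub_cancel]
  · have heq : c • (Measure.dirac a).toSignedMeasure + (1 - c) • ν.toSignedMeasure =
        (c.toNNReal • Measure.dirac a).toSignedMeasure -
          ((c - 1).toNNReal • ν).toSignedMeasure := by
      rw [Measure.toSignedMeasure_smul, Measure.toSignedMeasure_smul, NNReal.smul_def,
        NNReal.smul_def, Real.coe_toNNReal _ hc, Real.coe_toNNReal _ (sub_nonneg.2 h)]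
      ext i hi
      simp only [_root_.add_apply, _root_.sub_apply, _root_.smul_apply, smul_eq_mul]
      ring
    have hsing : c.toNNReal • Measure.dirac a ⟂ₘ (c - 1).toNNReal • ν :=
      ⟨{a}ᶜ, (measurableSet_singleton a).compl, by simp, by simp [ha]⟩
    rw [heq, totalVariation_sub_of_mutuallySingular hsing, max_eq_right (by linarith)]
    simp only [Measure.add_apply, Measure.smul_apply, measure_univ, ENNReal.smul_def, smul_eq_mul,
      mul_one, ENNReal.ofNNReal_toNNReal]
    rw [← ENNReal.ofReal_add hc (sub_nonneg.2 h)]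
    congr 1
    ring

/-- with `c := (η/μ)^{2/σ}`, the a.e. identity
`K_μ = c K_η + (1−c) K_μ ∗ K_η`, and the total variation of the signed measure
`K_{μ,η} := c δ₀ + (1−c) K_μ(x)dx` equals `max(1, 2(η/μ)^{2/σ} − 1)`;
in particular it equals `1` whenever `η ≤ μ`. -/
theorem stmt4 (d : ℕ) (hd : 1 ≤ d) (σ : ℝ) (hσ : 0 < σ) (μ η : ℝ) (hμ : 0 < μ) (hη : 0 < η)
    (c : ℝ) (hc : c = (η / μ) ^ ((2 : ℝ) / σ))
    [IsFiniteMeasure (Kmeas d σ μ)] :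
    (∀ᵐ x : Fin d → ℝ, KkerR d σ μ x =
        c * KkerR d σ η x + (1 - c) * ∫ z, KkerR d σ μ z * KkerR d σ η (x - z)) ∧
    ((c • (Measure.dirac (0 : Fin d → ℝ)).toSignedMeasure +
        (1 - c) • (Kmeas d σ μ).toSignedMeasure).totalVariation Set.univ =
      ENNReal.ofReal (max 1 (2 * (η / μ) ^ ((2 : ℝ) / σ) - 1))) ∧
    (η ≤ μ →
      (c • (Measure.dirac (0 : Fin d → ℝ)).toSignedMeasure +
        (1 - c) • (Kmeas d σ μ).toSignedMeasure).totalVariation Set.univ = 1) := by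
  have hη' : 0 ≤ η / μ := by positivity
  have : Nonempty (Fin d) := ⟨⟨0, hd⟩⟩
  have : IsProbabilityMeasure (Kmeas d σ μ) := ⟨by
    rw [Kmeas, withDensity_apply _ MeasurableSet.univ, Measure.restrict_univ,
      lintegral_Kker d σ hμ]⟩
  have hzero : Kmeas d σ μ {0} = 0 :=
    withDensity_absolutelyContinuous _ _ (measure_singleton 0)
  have htv : (c • (Measure.dirac (0 : Fin d → ℝ)).toSignedMeasure +
      (1 - c) • (Kmeas d σ μ).toSignedMeasure).totalVariation Set.univ =
        ENNReal.ofReal (max 1 (2 * (η / μ) ^ ((2 : ℝ) / σ) - 1)) := by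
    rw [totalVariation_smul_dirac_add_smul 0 hzero (hc ▸ Real.rpow_nonneg hη' _), hc]
  refine ⟨?_, htv, fun h => ?_⟩
  · rw [hc]
    exact KkerR_eq_add_convolution d σ hσ hμ hη
  · have hle : (η / μ) ^ ((2 : ℝ) / σ) ≤ 1 :=
      Real.rpow_le_one hη' ((div_le_one hμ).2 h) (by positivity)
    rw [htv, max_eq_left (by linarith), ENNReal.ofReal_one]
end

section
/- Let g ∈ ℕ₊ and let a ∈ ℕ^d be a multi-index with |a| ≤ g. Then for every μ > 0 the function K_μ^{*g} ∈ L^1(ℝ^d) admits a distributional derivative ∂^a K_μ^{*g} ∈ L^1(ℝ^d), and there exists a constant C = C(d, σ, g, a) > 0 such that ‖∂^a K_μ^{*g}‖_{L^1(ℝ^d)} ≤ C [μ]^{−|a|} for all μ > 0. -/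
open MeasureTheory ENNReal Real

/-- Convolution powers `K_μ^{*g}` as measures; `K_μ^{*0} = δ₀`. -/
noncomputable def Kpow (d : ℕ) (σ μ : ℝ) : ℕ → Measure (Fin d → ℝ)
  | 0 => Measure.dirac 0
  | g + 1 => (Kmeas d σ μ).conv (Kpow d σ μ g)

/-- Partial derivative in the `i`-th coordinate direction. -/
noncomputable def pder (d : ℕ) (i : Fin d) (f : (Fin d → ℝ) → ℝ) : (Fin d → ℝ) → ℝ :=
  fun x => fderiv ℝ f x (Pi.single i 1)

/-- Iterated partial derivative `∂^a` for a multi-index `a ∈ ℕ^d`. -/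
noncomputable def mpder (d : ℕ) (a : Fin d → ℕ) (f : (Fin d → ℝ) → ℝ) : (Fin d → ℝ) → ℝ :=
  (List.finRange d).foldr (fun i g => (pder d i)^[a i] g) f

/-- The iterated partial derivative along a list of coordinate directions. -/
noncomputable def pderList (d : ℕ) (L : List (Fin d)) (f : (Fin d → ℝ) → ℝ) : (Fin d → ℝ) → ℝ :=
  L.foldr (pder d) f

theorem mpder_eq_pderList (d : ℕ) (a : Fin d → ℕ) (f : (Fin d → ℝ) → ℝ) :
    mpder d a f =
      pderList d ((List.finRange d).flatMap fun i => List.replicate (a i) i) f := by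
  have h (n : ℕ) (i : Fin d) (f : (Fin d → ℝ) → ℝ) :
      (pder d i)^[n] f = (List.replicate n i).foldr (pder d) f := by
    induction n with
    | zero => rfl
    | succ n ih => rw [Function.iterate_succ_apply', ih, List.replicate_succ, List.foldr_cons]
  simp only [mpder, pderList, List.foldr_flatMap, h]

theorem pderList_append {d : ℕ} (L L' : List (Fin d)) (f : (Fin d → ℝ) → ℝ) :
    pderList d (L ++ L') f = pderList d L (pderList d L' f) :=
  List.foldr_append

theorem pderList_comp_add_right {d : ℕ} (L : List (Fin d)) (f : (Fin d → ℝ) → ℝ)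
    (y : Fin d → ℝ) :
    pderList d L (fun x => f (x + y)) = fun x => pderList d L f (x + y) := by
  induction L with
  | nil => rfl
  | cons i L ih =>
    change pder d i (pderList d L fun x => f (x + y)) = _
    rw [ih]
    funext x
    simp only [pder, fderiv_comp_add_right]
    rfl

/-- Test functions: all iterated partial derivatives are `C¹` and bounded. -/
def IsBddSmooth {d : ℕ} (f : (Fin d → ℝ) → ℝ) : Prop :=
  ∀ L : List (Fin d), ContDiff ℝ 1 (pderList d L f) ∧ ∃ C : ℝ, ∀ x, ‖pderList d L f x‖ ≤ C

namespace IsBddSmooth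

variable {d : ℕ} {f : (Fin d → ℝ) → ℝ}

theorem contDiff (hf : IsBddSmooth f) : ContDiff ℝ 1 f := (hf []).1

theorem continuous (hf : IsBddSmooth f) : Continuous f := hf.contDiff.continuous

theorem bounded (hf : IsBddSmooth f) : ∃ C : ℝ, ∀ x, ‖f x‖ ≤ C := (hf []).2

theorem pderList (hf : IsBddSmooth f) (L : List (Fin d)) : IsBddSmooth (pderList d L f) :=
  fun L' => by
    rw [← pderList_append]
    exact hf _

theorem comp_add_right (hf : IsBddSmooth f) (y : Fin d → ℝ) : IsBddSmooth fun x => f (x + y) :=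
  fun L => by
    rw [pderList_comp_add_right]
    obtain ⟨h, C, hC⟩ := hf L
    exact ⟨h.comp (by fun_prop), C, fun x => hC _⟩

end IsBddSmooth

open LineDeriv in
theorem SchwartzMap.isBddSmooth {d : ℕ} (ψ : SchwartzMap (Fin d → ℝ) ℝ) :
    IsBddSmooth (ψ : (Fin d → ℝ) → ℝ) := by
  intro L
  obtain ⟨φ, hφ⟩ : ∃ φ : SchwartzMap (Fin d → ℝ) ℝ, pderList d L ψ = φ := by
    induction L with
    | nil => exact ⟨ψ, rfl⟩
    | cons i L ih =>
      obtain ⟨φ, hφ⟩ := ih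
      refine ⟨∂_{(Pi.single i 1 : Fin d → ℝ)} φ, ?_⟩
      change pder d i (pderList d L ψ) = _
      rw [hφ]
      rfl
  rw [hφ]
  exact ⟨φ.smooth 1, _, fun x => SchwartzMap.norm_le_seminorm ℝ φ x⟩

/-- `D` is an integrable density of the distributional derivative of `ν` along `L`, and
its `L¹` norm is at most `c`. -/
structure IsWeakDeriv {d : ℕ} (ν : Measure (Fin d → ℝ)) (L : List (Fin d))
    (D : (Fin d → ℝ) → ℝ) (c : ℝ) : Prop where
  integrable : Integrable D
  pairing : ∀ f, IsBddSmooth f →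
    ∫ x, pderList d L f x ∂ν = (-1 : ℝ) ^ L.length * ∫ x, D x * f x
  norm_le : ∫ x, ‖D x‖ ≤ c

open ContinuousLinearMap in
theorem IsWeakDeriv.conv {d : ℕ} {ν ν' : Measure (Fin d → ℝ)} [IsFiniteMeasure ν]
    [IsFiniteMeasure ν'] {L L' : List (Fin d)} {D D' : (Fin d → ℝ) → ℝ} {c c' : ℝ}
    (h : IsWeakDeriv ν L D c) (h' : IsWeakDeriv ν' L' D' c') :
    IsWeakDeriv (ν.conv ν') (L ++ L') (convolution D D' (mul ℝ ℝ) volume) (c * c') where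
  integrable := h.integrable.integrable_convolution _ h'.integrable
  pairing f hf := by
    have hψ := hf.pderList L'
    have hφ := hψ.pderList L
    obtain ⟨A, hA⟩ := hf.bounded
    obtain ⟨B, hB⟩ := hψ.bounded
    obtain ⟨C, hC⟩ := hφ.bounded
    rw [pderList_append, integral_conv, integral_integral_swap]
    rotate_left
    · refine Integrable.of_bound (Continuous.aestronglyMeasurable ?_) C (.of_forall fun p => hC _)
      exact hφ.continuous.comp (by fun_prop)
    · exact Integrable.of_bound hφ.continuous.aestronglyMeasurable C (.of_forall hC)
    set ψ := pderList d L' f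
    have hL (y : Fin d → ℝ) : ∫ x, pderList d L ψ (x + y) ∂ν
        = (-1 : ℝ) ^ L.length * ∫ x, D x * ψ (x + y) := by
      rw [← h.pairing _ (hψ.comp_add_right y), pderList_comp_add_right]
    have hL' (x : Fin d → ℝ) : ∫ y, ψ (x + y) ∂ν'
        = (-1 : ℝ) ^ L'.length * ∫ y, D' y * f (x + y) := by
      have := h'.pairing _ (hf.comp_add_right x)
      rw [pderList_comp_add_right] at this
      simpa only [add_comm] using this
    have hsub (x : Fin d → ℝ) : ∫ y, D' y * f (x + y) = ∫ y, D' (y - x) * f y := by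
      rw [← integral_sub_right_eq_self (fun y => D' y * f (x + y)) x]
      simp only [add_sub_cancel]
    have hint : Integrable (fun p : (Fin d → ℝ) × (Fin d → ℝ) => D p.2 * ψ (p.2 + p.1))
        (ν'.prod volume) :=
      (h.integrable.comp_snd ν').mul_bdd
        (hψ.continuous.comp (by fun_prop)).aestronglyMeasurable (.of_forall fun p => hB _)
    have hint' : Integrable (fun p : (Fin d → ℝ) × (Fin d → ℝ) =>
        D p.2 * D' (p.1 - p.2) * f p.1) (volume.prod volume) :=
      (h.integrable.convolution_integrand (mul ℝ ℝ) h'.integrable).mul_bdd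
        (hf.continuous.comp (by fun_prop)).aestronglyMeasurable (.of_forall fun p => hA _)
    simp_rw [hL, integral_const_mul]
    rw [integral_integral_swap hint]
    simp_rw [integral_const_mul, hL']
    simp_rw [convolution_def, mul_apply', ← integral_mul_const]
    rw [integral_integral_swap hint', List.length_append, pow_add]
    simp_rw [mul_assoc, integral_const_mul, mul_left_comm (D _) ((-1 : ℝ) ^ L'.length),
      integral_const_mul, hsub]
  norm_le := by
    have h1 := h.integrable.norm.integrable_convolution (mul ℝ ℝ) h'.integrable.norm
    calc ∫ x, ‖convolution D D' (mul ℝ ℝ) volume x‖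
        ≤ ∫ x, convolution (fun t => ‖D t‖) (fun t => ‖D' t‖) (mul ℝ ℝ) volume x := by
          refine integral_mono_of_nonneg (.of_forall fun _ => norm_nonneg _) h1
            (.of_forall fun x => ?_)
          refine (norm_integral_le_integral_norm _).trans_eq ?_
          simp [convolution_def]
      _ = (∫ x, ‖D x‖) * ∫ x, ‖D' x‖ :=
          integral_convolution (mul ℝ ℝ) h.integrable.norm h'.integrable.norm
      _ ≤ c * c' := mul_le_mul h.norm_le h'.norm_le (integral_nonneg fun _ => norm_nonneg _)
          ((integral_nonneg fun _ => norm_nonneg _).trans h.norm_le)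

section Gaussian

variable {d : ℕ}

theorem exp_neg_sum_sq_div (b : ℝ) (x : Fin d → ℝ) :
    rexp (-(∑ i, x i ^ 2) / b) = ∏ i, rexp (-b⁻¹ * x i ^ 2) := by
  rw [← Real.exp_sum, ← Finset.mul_sum]
  congr 1
  ring

theorem integrable_exp_neg_sum_sq_div {b : ℝ} (hb : 0 < b) :
    Integrable fun x : Fin d → ℝ => rexp (-(∑ i, x i ^ 2) / b) := by
  simp_rw [exp_neg_sum_sq_div]
  exact Integrable.fintype_prod fun _ => integrable_exp_neg_mul_sq (inv_pos.2 hb)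

theorem integral_exp_neg_sum_sq_div {b : ℝ} (hb : 0 < b) :
    ∫ x : Fin d → ℝ, rexp (-(∑ i, x i ^ 2) / b) = (π * b) ^ ((d : ℝ) / 2) := by
  simp_rw [exp_neg_sum_sq_div]
  rw [integral_fintype_prod_volume_eq_pow fun y : ℝ => rexp (-b⁻¹ * y ^ 2), integral_gaussian,
    div_inv_eq_mul, Fintype.card_fin, Real.sqrt_eq_rpow, ← Real.rpow_natCast,
    ← Real.rpow_mul (by positivity)]
  congr 1
  ring

end Gaussian

/-- The heat kernel at time `t * M`, weighted by `exp (-t)`. -/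
noncomputable def weightedHeat (d : ℕ) (M t : ℝ) (x : Fin d → ℝ) : ℝ :=
  rexp (-t) * (4 * π * t * M) ^ (-(d : ℝ) / 2) * rexp (-(∑ i, x i ^ 2) / (4 * t * M))

section WeightedHeat

variable {d : ℕ} {M t : ℝ}

theorem weightedHeat_nonneg (hM : 0 < M) (ht : 0 < t) (x : Fin d → ℝ) :
    0 ≤ weightedHeat d M t x := by
  unfold weightedHeat
  positivity

theorem integrable_weightedHeat (hM : 0 < M) (ht : 0 < t) : Integrable (weightedHeat d M t) :=
  (integrable_exp_neg_sum_sq_div (by positivity)).const_mul _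

theorem integral_weightedHeat (hM : 0 < M) (ht : 0 < t) :
    ∫ x, weightedHeat d M t x = rexp (-t) := by
  unfold weightedHeat
  rw [integral_const_mul, integral_exp_neg_sum_sq_div (by positivity), neg_div,
    Real.rpow_neg (by positivity), show π * (4 * t * M) = 4 * π * t * M by ring, mul_assoc,
    inv_mul_cancel₀ (by positivity), mul_one]

theorem hasFDerivAt_weightedHeat (x : Fin d → ℝ) :
    HasFDerivAt (weightedHeat d M t)
      ((-weightedHeat d M t x / (4 * t * M)) •
        ∑ i, (2 * x i) • (ContinuousLinearMap.proj i : (Fin d → ℝ) →L[ℝ] ℝ)) x := by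
  have h1 : HasFDerivAt (fun y : Fin d → ℝ => ∑ i, y i ^ 2)
      (∑ i, (2 * x i) • (ContinuousLinearMap.proj i : (Fin d → ℝ) →L[ℝ] ℝ)) x := by
    refine HasFDerivAt.fun_sum fun i _ => ?_
    simpa using (hasFDerivAt_apply (𝕜 := ℝ) i x).pow 2
  have h2 := ((h1.neg.mul_const (4 * t * M)⁻¹).exp).const_mul
    (rexp (-t) * (4 * π * t * M) ^ (-(d : ℝ) / 2))
  simp only [← div_eq_mul_inv] at h2
  refine h2.congr_fderiv ?_
  simp only [weightedHeat, smul_neg, smul_smul, ← neg_smul]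
  congr 1
  simp only [Pi.neg_apply]
  ring

theorem fderiv_weightedHeat_single (x : Fin d → ℝ) (i : Fin d) :
    fderiv ℝ (weightedHeat d M t) x (Pi.single i 1)
      = -(x i / (2 * t * M)) * weightedHeat d M t x := by
  rw [(hasFDerivAt_weightedHeat x).fderiv]
  simp only [smul_apply, sum_apply,
    ContinuousLinearMap.proj_apply, smul_eq_mul, Pi.single_apply, mul_ite, mul_one, mul_zero,
    Finset.sum_ite_eq', Finset.mem_univ, if_true]
  field_simp
  ring

theorem measurable_weightedHeat :
    Measurable fun p : ℝ × (Fin d → ℝ) => weightedHeat d M p.1 p.2 := by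
  unfold weightedHeat
  fun_prop

theorem abs_le_sqrt_mul_exp (y : ℝ) {s : ℝ} (hs : 0 < s) : |y| ≤ √s * rexp (y ^ 2 / s) := by
  have hs' := Real.sqrt_pos.2 hs
  have h1 := Real.add_one_le_exp ((|y| / √s) ^ 2)
  rw [div_pow, sq_abs, Real.sq_sqrt hs.le] at h1
  have h2 : |y| / √s ≤ rexp (y ^ 2 / s) := by
    have h3 : (|y| / √s) ^ 2 = y ^ 2 / s := by rw [div_pow, sq_abs, Real.sq_sqrt hs.le]
    nlinarith [sq_nonneg (|y| / √s - 1)]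
  rw [div_le_iff₀ hs'] at h2
  linarith

theorem norm_fderiv_weightedHeat_le (hM : 0 < M) (ht : 0 < t) (x : Fin d → ℝ) (i : Fin d) :
    ‖fderiv ℝ (weightedHeat d M t) x (Pi.single i 1)‖ ≤
      √(8 * t * M) / (2 * t * M) * (rexp (-t) * (4 * π * t * M) ^ (-(d : ℝ) / 2)) *
        rexp (-(∑ j, x j ^ 2) / (8 * t * M)) := by
  have hs : 0 < 8 * t * M := by positivity
  have h1 : |x i| ≤ √(8 * t * M) * rexp ((∑ j, x j ^ 2) / (8 * t * M)) := by
    refine (abs_le_sqrt_mul_exp (x i) hs).trans ?_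
    gcongr
    exact Finset.single_le_sum (f := fun j => x j ^ 2) (fun _ _ => sq_nonneg _)
      (Finset.mem_univ i)
  have h2 : rexp ((∑ j, x j ^ 2) / (8 * t * M)) * rexp (-(∑ j, x j ^ 2) / (4 * t * M))
      = rexp (-(∑ j, x j ^ 2) / (8 * t * M)) := by
    rw [← Real.exp_add]
    congr 1
    field_simp
    ring
  rw [fderiv_weightedHeat_single, norm_mul, norm_neg, norm_div, Real.norm_eq_abs,
    Real.norm_of_nonneg (by positivity : 0 ≤ 2 * t * M),
    Real.norm_of_nonneg (weightedHeat_nonneg hM ht x), weightedHeat]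
  calc _ ≤ √(8 * t * M) * rexp ((∑ j, x j ^ 2) / (8 * t * M)) / (2 * t * M) *
        (rexp (-t) * (4 * π * t * M) ^ (-(d : ℝ) / 2) *
          rexp (-(∑ i, x i ^ 2) / (4 * t * M))) := by gcongr
    _ = _ := by
      rw [← h2]
      ring

theorem integrable_fderiv_weightedHeat (hM : 0 < M) (ht : 0 < t) (i : Fin d) :
    Integrable fun x => fderiv ℝ (weightedHeat d M t) x (Pi.single i 1) := by
  refine ((integrable_exp_neg_sum_sq_div (by positivity)).const_mul _).mono' ?_
    (.of_forall fun x => norm_fderiv_weightedHeat_le hM ht x i)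
  simp_rw [fderiv_weightedHeat_single]
  unfold weightedHeat
  exact (by fun_prop : Measurable _).aestronglyMeasurable

theorem integral_norm_fderiv_weightedHeat_le (hM : 0 < M) (ht : 0 < t) (i : Fin d) :
    ∫ x, ‖fderiv ℝ (weightedHeat d M t) x (Pi.single i 1)‖ ≤
      √2 * 2 ^ ((d : ℝ) / 2) * M ^ (-(1 / 2) : ℝ) * (rexp (-t) * t ^ ((1 / 2 : ℝ) - 1)) := by
  refine (integral_mono (integrable_fderiv_weightedHeat hM ht i).norm
    ((integrable_exp_neg_sum_sq_div (by positivity)).const_mul _)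
    fun x => norm_fderiv_weightedHeat_le hM ht x i).trans_eq ?_
  rw [integral_const_mul, integral_exp_neg_sum_sq_div (by positivity),
    show π * (8 * t * M) = 2 * (4 * π * t * M) by ring,
    Real.mul_rpow (x := 2) (y := 4 * π * t * M) (by positivity) (by positivity), neg_div, Real.rpow_neg (by positivity)]
  have h1 : √(8 * t * M) / (2 * t * M) = √2 * M ^ (-(1 / 2) : ℝ) * t ^ ((1 / 2 : ℝ) - 1) := by
    rw [show (1 / 2 : ℝ) - 1 = -(1 / 2) by norm_num, Real.rpow_neg hM.le, Real.rpow_neg ht.le,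
      ← Real.sqrt_eq_rpow, ← Real.sqrt_eq_rpow, show 8 * t * M = 2 ^ 2 * (2 * (t * M)) by ring,
      Real.sqrt_mul (by positivity), Real.sqrt_sq (by norm_num), Real.sqrt_mul (by norm_num),
      Real.sqrt_mul ht.le]
    have h2 := Real.mul_self_sqrt ht.le
    have h3 := Real.mul_self_sqrt hM.le
    have h4 := Real.sqrt_pos.2 ht
    have h5 := Real.sqrt_pos.2 hM
    field_simp
    rw [sq, sq, h2, h3]
  have h6 : ((4 * π * t * M) ^ ((d : ℝ) / 2))⁻¹ * (4 * π * t * M) ^ ((d : ℝ) / 2) = 1 :=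
    inv_mul_cancel₀ (by positivity)
  rw [h1]
  linear_combination (√2 * M ^ (-(1 / 2) : ℝ) * t ^ ((1 / 2 : ℝ) - 1) * rexp (-t) *
    2 ^ ((d : ℝ) / 2)) * h6

theorem integral_weightedHeat_mul_pder (hM : 0 < M) (ht : 0 < t) (i : Fin d)
    {f : (Fin d → ℝ) → ℝ} (hf : IsBddSmooth f) :
    ∫ x, weightedHeat d M t x * pder d i f x
      = -∫ x, fderiv ℝ (weightedHeat d M t) x (Pi.single i 1) * f x := by
  obtain ⟨A, hA⟩ := hf.bounded
  obtain ⟨B, hB⟩ := (hf.pderList [i]).bounded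
  exact integral_mul_fderiv_eq_neg_fderiv_mul_of_integrable
    ((integrable_fderiv_weightedHeat hM ht i).mul_bdd hf.continuous.aestronglyMeasurable
      (.of_forall hA))
    ((integrable_weightedHeat hM ht).mul_bdd
      (hf.pderList [i]).continuous.aestronglyMeasurable (.of_forall hB))
    ((integrable_weightedHeat hM ht).mul_bdd hf.continuous.aestronglyMeasurable (.of_forall hA))
    (fun x _ => (hasFDerivAt_weightedHeat x).differentiableAt)
    fun x _ => hf.contDiff.differentiable one_ne_zero x

end WeightedHeat

section Mixture

variable {α β : Type*} [MeasurableSpace α] [MeasurableSpace β] {ρ : Measure α} {ν : Measure β}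
  [SFinite ν] {H : α → β → ℝ} {b : α → ℝ}

theorem integrable_uncurry_of_integral_norm_le
    (hH : AEStronglyMeasurable (Function.uncurry H) (ρ.prod ν))
    (hint : ∀ᵐ t ∂ρ, Integrable (H t) ν) (hb : Integrable b ρ)
    (hle : ∀ᵐ t ∂ρ, ∫ x, ‖H t x‖ ∂ν ≤ b t) : Integrable (Function.uncurry H) (ρ.prod ν) := by
  refine (integrable_prod_iff hH).2 ⟨hint, hb.mono' hH.norm.integral_prod_right' ?_⟩
  filter_upwards [hle] with t ht
  rwa [Real.norm_of_nonneg (integral_nonneg fun _ => norm_nonneg _)]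

variable [SFinite ρ]

theorem integral_norm_integral_le (hH : Integrable (Function.uncurry H) (ρ.prod ν))
    (hb : Integrable b ρ) (hle : ∀ᵐ t ∂ρ, ∫ x, ‖H t x‖ ∂ν ≤ b t) :
    ∫ x, ‖∫ t, H t x ∂ρ‖ ∂ν ≤ ∫ t, b t ∂ρ :=
  calc ∫ x, ‖∫ t, H t x ∂ρ‖ ∂ν ≤ ∫ x, ∫ t, ‖H t x‖ ∂ρ ∂ν :=
        integral_mono hH.integral_prod_right.norm hH.norm.integral_prod_right
          fun _ => norm_integral_le_integral_norm _
    _ = ∫ t, ∫ x, ‖H t x‖ ∂ν ∂ρ := (integral_integral_swap hH.norm).symm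
    _ ≤ ∫ t, b t ∂ρ := integral_mono_ae hH.norm.integral_prod_left hb hle

theorem integral_integral_mul_of_bounded (hH : Integrable (Function.uncurry H) (ρ.prod ν))
    {f : β → ℝ} (hf : Measurable f) {C : ℝ} (hC : ∀ x, ‖f x‖ ≤ C) :
    ∫ x, (∫ t, H t x ∂ρ) * f x ∂ν = ∫ t, ∫ x, H t x * f x ∂ν ∂ρ := by
  simp_rw [← integral_mul_const]
  have h : Integrable (fun p : α × β => H p.1 p.2 * f p.2) (ρ.prod ν) :=
    hH.mul_bdd (hf.comp measurable_snd).aestronglyMeasurable (.of_forall fun p => hC _)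
  exact (integral_integral_swap h).symm

end Mixture

theorem integrable_uncurry_weightedHeat {d : ℕ} {M : ℝ} (hM : 0 < M) :
    Integrable (Function.uncurry (weightedHeat d M))
      ((volume.restrict (Set.Ioi (0 : ℝ))).prod volume) := by
  refine integrable_uncurry_of_integral_norm_le measurable_weightedHeat.aestronglyMeasurable
    (ae_restrict_of_forall_mem measurableSet_Ioi fun t ht => integrable_weightedHeat hM ht)
    (integrableOn_exp_neg_Ioi 0)
    (ae_restrict_of_forall_mem measurableSet_Ioi fun t ht => ?_)
  simp_rw [Real.norm_of_nonneg (weightedHeat_nonneg hM ht _)]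
  exact (integral_weightedHeat hM ht).le

/-- The kernel `K_μ` as a real-valued function, with `M = [μ]²`. -/
noncomputable def besselKernel (d : ℕ) (M : ℝ) (x : Fin d → ℝ) : ℝ :=
  ∫ t in Set.Ioi (0 : ℝ), weightedHeat d M t x

/-- The `i`-th partial derivative of `besselKernel`. -/
noncomputable def besselKernelDeriv (d : ℕ) (M : ℝ) (i : Fin d) (x : Fin d → ℝ) : ℝ :=
  ∫ t in Set.Ioi (0 : ℝ), fderiv ℝ (weightedHeat d M t) x (Pi.single i 1)

theorem besselKernel_nonneg {d : ℕ} {M : ℝ} (hM : 0 < M) (x : Fin d → ℝ) :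
    0 ≤ besselKernel d M x :=
  setIntegral_nonneg measurableSet_Ioi fun _ ht => weightedHeat_nonneg hM ht x

theorem integrable_besselKernel {d : ℕ} {M : ℝ} (hM : 0 < M) : Integrable (besselKernel d M) :=
  (integrable_uncurry_weightedHeat hM).integral_prod_right

theorem Kmeas_eq_withDensity_besselKernel (d : ℕ) (σ : ℝ) {μ : ℝ} (hμ : 0 < μ) :
    Kmeas d σ μ =
      volume.withDensity fun x => ENNReal.ofReal (besselKernel d (μ ^ ((2 : ℝ) / σ)) x) := by
  have hM : 0 < μ ^ ((2 : ℝ) / σ) := by positivity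
  refine withDensity_congr_ae ?_
  filter_upwards [(integrable_uncurry_weightedHeat (d := d) hM).prod_left_ae] with x hx
  exact (ofReal_integral_eq_lintegral_ofReal hx
    (ae_restrict_of_forall_mem measurableSet_Ioi fun t ht => weightedHeat_nonneg hM ht x)).symm

instance isFiniteMeasure_Kmeas (d : ℕ) (σ : ℝ) {μ : ℝ} [hμ : Fact (0 < μ)] :
    IsFiniteMeasure (Kmeas d σ μ) := by
  have hM : 0 < μ ^ ((2 : ℝ) / σ) := Real.rpow_pos_of_pos hμ.out _
  rw [Kmeas_eq_withDensity_besselKernel d σ hμ.out]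
  exact isFiniteMeasure_withDensity_ofReal (integrable_besselKernel hM).2

instance isFiniteMeasure_Kpow (d : ℕ) (σ : ℝ) {μ : ℝ} [Fact (0 < μ)] (g : ℕ) :
    IsFiniteMeasure (Kpow d σ μ g) := by
  induction g with
  | zero => exact inferInstanceAs (IsFiniteMeasure (Measure.dirac 0))
  | succ g ih => exact inferInstanceAs (IsFiniteMeasure ((Kmeas d σ μ).conv (Kpow d σ μ g)))

theorem integral_Kmeas (d : ℕ) (σ : ℝ) {μ : ℝ} (hμ : 0 < μ) (f : (Fin d → ℝ) → ℝ) :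
    ∫ x, f x ∂Kmeas d σ μ = ∫ x, besselKernel d (μ ^ ((2 : ℝ) / σ)) x * f x := by
  have hM : 0 < μ ^ ((2 : ℝ) / σ) := by positivity
  rw [Kmeas_eq_withDensity_besselKernel d σ hμ, integral_withDensity_eq_integral_toReal_smul₀
    (integrable_besselKernel hM).aestronglyMeasurable.aemeasurable.ennreal_ofReal
    (.of_forall fun _ => ENNReal.ofReal_lt_top)]
  refine integral_congr_ae (.of_forall fun x => ?_)
  simp only [smul_eq_mul]
  rw [ENNReal.toReal_ofReal (besselKernel_nonneg hM x)]

theorem isWeakDeriv_Kmeas_nil (d : ℕ) (σ : ℝ) {μ : ℝ} (hμ : 0 < μ) :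
    IsWeakDeriv (Kmeas d σ μ) [] (besselKernel d (μ ^ ((2 : ℝ) / σ))) 1 where
  integrable := integrable_besselKernel (by positivity)
  pairing f _ := by
    rw [integral_Kmeas d σ hμ, List.length_nil, pow_zero, one_mul]
    rfl
  norm_le := by
    have hM : 0 < μ ^ ((2 : ℝ) / σ) := by positivity
    refine (integral_norm_integral_le (integrable_uncurry_weightedHeat hM)
      (integrableOn_exp_neg_Ioi 0)
      (ae_restrict_of_forall_mem measurableSet_Ioi fun t ht => ?_)).trans_eq
      integral_exp_neg_Ioi_zero
    simp_rw [Real.norm_of_nonneg (weightedHeat_nonneg hM ht _)]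
    exact (integral_weightedHeat hM ht).le

theorem isWeakDeriv_Kmeas_singleton (d : ℕ) (σ : ℝ) {μ : ℝ} (hμ : 0 < μ) (i : Fin d) :
    IsWeakDeriv (Kmeas d σ μ) [i] (besselKernelDeriv d (μ ^ ((2 : ℝ) / σ)) i)
      (√2 * 2 ^ ((d : ℝ) / 2) * √π * μ ^ (-1 / σ)) := by
  set M := μ ^ ((2 : ℝ) / σ) with hM_def
  have hM : 0 < M := by positivity
  have hb : IntegrableOn (fun t : ℝ => √2 * 2 ^ ((d : ℝ) / 2) * M ^ (-(1 / 2) : ℝ) *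
      (rexp (-t) * t ^ ((1 / 2 : ℝ) - 1))) (Set.Ioi 0) :=
    (Real.GammaIntegral_convergent (by norm_num)).const_mul _
  have hle : ∀ᵐ t ∂(volume.restrict (Set.Ioi (0 : ℝ))),
      ∫ x, ‖fderiv ℝ (weightedHeat d M t) x (Pi.single i 1)‖ ≤
        √2 * 2 ^ ((d : ℝ) / 2) * M ^ (-(1 / 2) : ℝ) * (rexp (-t) * t ^ ((1 / 2 : ℝ) - 1)) :=
    ae_restrict_of_forall_mem measurableSet_Ioi fun t ht =>
      integral_norm_fderiv_weightedHeat_le hM ht i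
  have hint : Integrable (Function.uncurry fun t x =>
      fderiv ℝ (weightedHeat d M t) x (Pi.single i 1))
      ((volume.restrict (Set.Ioi (0 : ℝ))).prod volume) := by
    refine integrable_uncurry_of_integral_norm_le ?_
      (ae_restrict_of_forall_mem measurableSet_Ioi fun t ht =>
        integrable_fderiv_weightedHeat hM ht i) hb hle
    simp_rw [fderiv_weightedHeat_single]
    refine Measurable.aestronglyMeasurable (Measurable.mul ?_ measurable_weightedHeat)
    fun_prop
  refine ⟨hint.integral_prod_right, fun f hf => ?_, ?_⟩
  · have hf' := hf.pderList [i]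
    obtain ⟨A, hA⟩ := hf.bounded
    obtain ⟨B, hB⟩ := hf'.bounded
    rw [integral_Kmeas d σ hμ]
    unfold besselKernel besselKernelDeriv
    rw [integral_integral_mul_of_bounded (integrable_uncurry_weightedHeat hM)
      hf'.continuous.measurable hB,
      integral_integral_mul_of_bounded hint hf.continuous.measurable hA,
      List.length_singleton, pow_one, neg_one_mul, ← integral_neg]
    exact setIntegral_congr_fun measurableSet_Ioi fun t ht =>
      integral_weightedHeat_mul_pder hM ht i hf
  · refine (integral_norm_integral_le hint hb hle).trans_eq ?_
    rw [integral_const_mul, ← Real.Gamma_eq_integral (by norm_num), Real.Gamma_one_half_eq,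
      hM_def, ← Real.rpow_mul hμ.le, show 2 / σ * -(1 / 2) = -1 / σ by ring]
    ring

theorem exists_isWeakDeriv_Kpow (d : ℕ) (σ : ℝ) {μ : ℝ} (hμ : 0 < μ) {g : ℕ} (hg : 1 ≤ g)
    (L : List (Fin d)) (hL : L.length ≤ g) :
    ∃ D, IsWeakDeriv (Kpow d σ μ g) L D
      ((√2 * 2 ^ ((d : ℝ) / 2) * √π * μ ^ (-1 / σ)) ^ L.length) := by
  have : Fact (0 < μ) := ⟨hμ⟩
  induction g, hg using Nat.le_induction generalizing L with
  | base =>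
    have h1 : Kpow d σ μ 1 = Kmeas d σ μ := Measure.conv_dirac_zero _
    rw [h1]
    match L with
    | [] => exact ⟨_, by simpa using isWeakDeriv_Kmeas_nil d σ hμ⟩
    | [i] => exact ⟨_, by simpa using isWeakDeriv_Kmeas_singleton d σ hμ i⟩
    | _ :: _ :: _ => simp at hL
  | succ g _ ih =>
    match L with
    | [] =>
      obtain ⟨D, hD⟩ := ih [] (Nat.zero_le _)
      exact ⟨_, by simpa [Kpow] using (isWeakDeriv_Kmeas_nil d σ hμ).conv hD⟩
    | i :: L =>
      obtain ⟨D, hD⟩ := ih L (by simpa using hL)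
      rw [List.length_cons, pow_succ']
      exact ⟨_, (isWeakDeriv_Kmeas_singleton d σ hμ i).conv hD⟩

/-- for `g ≥ 1` and a multi-index `a` with `|a| ≤ g`, the distributional
derivative `∂^a K_μ^{*g}` exists as an `L¹` function `D`, i.e.
`∫ ∂^a ψ dK_μ^{*g} = (−1)^{|a|} ∫ D·ψ dx` for every Schwartz function `ψ`, with
`‖D‖_{L¹} ≤ C [μ]^{−|a|}` for a constant `C = C(d,σ,g,a)` uniformly in `μ > 0`. -/
theorem stmt6 (d : ℕ) (hd : 1 ≤ d) (σ : ℝ) (hσ : 0 < σ) (g : ℕ) (hg : 1 ≤ g)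
    (a : Fin d → ℕ) (ha : ∑ i, a i ≤ g) :
    ∃ C : ℝ, 0 < C ∧ ∀ μ : ℝ, 0 < μ →
      ∃ D : (Fin d → ℝ) → ℝ, Integrable D ∧
        (∀ ψ : SchwartzMap ((Fin d) → ℝ) ℝ,
          ∫ x, mpder d a (⇑ψ) x ∂(Kpow d σ μ g) = (-1 : ℝ) ^ (∑ i, a i) * ∫ x, D x * ψ x) ∧
        (∫⁻ x, (‖D x‖₊ : ℝ≥0∞)) ≤ ENNReal.ofReal (C * μ ^ (-((∑ i, a i : ℕ) : ℝ) / σ)) := by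
  refine ⟨(√2 * 2 ^ ((d : ℝ) / 2) * √π) ^ (∑ i, a i), by positivity, fun μ hμ => ?_⟩
  set L := (List.finRange d).flatMap fun i => List.replicate (a i) i with hL_def
  have hL : L.length = ∑ i, a i := by
    simp [hL_def, List.length_flatMap, List.sum_ofFn, ← List.ofFn_eq_map]
  obtain ⟨D, hD⟩ := exists_isWeakDeriv_Kpow d σ hμ hg L (hL.trans_le ha)
  refine ⟨D, hD.integrable, fun ψ => ?_, ?_⟩
  · rw [mpder_eq_pderList, hD.pairing _ ψ.isBddSmooth, hL]
  · refine (ofReal_integral_norm_eq_lintegral_enorm hD.integrable).symm.trans_le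
      (ENNReal.ofReal_le_ofReal (hD.norm_le.trans_eq ?_))
    rw [hL, mul_pow, ← Real.rpow_mul_natCast hμ.le]
    congr 2
    ring
end

section
/- There exists a constant C = C(d, σ, p) > 0 such that for every p ∈ [1, ∞) and all μ ∈ (0,1], the periodization of the d-fold convolution power of K_μ satisfies ‖𝐓(K_μ^{*d})‖_{L^p(𝕋)} ≤ C [μ]^{−d(p−1)/p}; moreover ‖𝐓(K_μ^{*d})‖_{L^∞(𝕋)} ≤ C [μ]^{−d} uniformly in μ ∈ (0,1]. -/
open MeasureTheory ENNReal Real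

/-- Density of the convolution power `K_μ^{*(n+1)}`. -/
noncomputable def kdens (d : ℕ) (σ μ : ℝ) : ℕ → (Fin d → ℝ) → ℝ≥0∞
  | 0 => Kker d σ μ
  | n + 1 => fun x => ∫⁻ z, Kker d σ μ z * kdens d σ μ n (x - z)

/-- Periodization `𝐓(K_μ^{*d})(x) = Σ_{k ∈ ℤ^d} K_μ^{*d}(x + 2πk)`. -/
noncomputable def perKd (d : ℕ) (σ μ : ℝ) (x : Fin d → ℝ) : ℝ≥0∞ :=
  ∑' k : Fin d → ℤ, kdens d σ μ (d - 1) (x + fun i => 2 * π * (k i : ℝ))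

open ProbabilityTheory

theorem lintegral_prod_eval_eq_prod_lintegral {n : ℕ} {f : Fin n → ℝ → ℝ≥0∞}
    (hf : ∀ i, Measurable (f i)) :
    ∫⁻ x : Fin n → ℝ, ∏ i, f i (x i) = ∏ i, ∫⁻ x, f i x := by
  induction n with
  | zero => simp [MeasureTheory.volume_pi]
  | succ n ih =>
    have hmp := (volume_preserving_piFinSuccAbove (fun _ : Fin (n + 1) => ℝ) 0).symm
    rw [← hmp.lintegral_comp (by fun_prop)]
    simp_rw [MeasurableEquiv.piFinSuccAbove_symm_apply, Fin.insertNthEquiv,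
      Fin.prod_univ_succ, Fin.insertNth_zero]
    simp only [Equiv.coe_fn_mk, Fin.cons_zero, Fin.cons_succ, cast_eq]
    rw [Measure.volume_eq_prod, lintegral_prod_mul (hf 0).aemeasurable
      (g := fun y : Fin n → ℝ => ∏ i, f i.succ (y i))
      (Finset.measurable_prod _ fun i _ => (hf i.succ).comp (measurable_pi_apply i)).aemeasurable,
      ih fun i => hf i.succ]

theorem ENNReal.tsum_pi_prod_le {n : ℕ} {β : Type*} (f : Fin n → β → ℝ≥0∞) :
    ∑' k : Fin n → β, ∏ i, f i (k i) ≤ ∏ i, ∑' b, f i b := by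
  classical
  refine ENNReal.summable.tsum_le_of_sum_le fun s => ?_
  calc ∑ k ∈ s, ∏ i, f i (k i)
      ≤ ∑ k ∈ Fintype.piFinset fun i => s.image fun k => k i, ∏ i, f i (k i) := by
        refine Finset.sum_le_sum_of_subset fun k hk => ?_
        simp only [Fintype.mem_piFinset, Finset.mem_image]
        exact fun i => ⟨k, hk, rfl⟩
    _ = ∏ i, ∑ b ∈ s.image fun k => k i, f i b := (Finset.prod_univ_sum _ _).symm
    _ ≤ ∏ i, ∑' b, f i b := Finset.prod_le_prod' fun i _ => ENNReal.sum_le_tsum _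

/-- The centred Gaussian density of variance `v` in each of the `d` coordinates. -/
noncomputable def piGaussian (d : ℕ) (v : ℝ) (x : Fin d → ℝ) : ℝ≥0∞ :=
  ∏ i, gaussianPDF 0 v.toNNReal (x i)

@[fun_prop]
theorem Measurable.piGaussian {α : Type*} [MeasurableSpace α] {d : ℕ} {v : α → ℝ}
    {x : α → Fin d → ℝ} (hv : Measurable v) (hx : Measurable x) :
    Measurable fun a => piGaussian d (v a) (x a) := by
  unfold _root_.piGaussian gaussianPDF gaussianPDFReal
  fun_prop

theorem lintegral_piGaussian (d : ℕ) {v : ℝ} (hv : 0 < v) : ∫⁻ x, piGaussian d v x = 1 := by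
  unfold piGaussian
  rw [lintegral_prod_eval_eq_prod_lintegral fun i => measurable_gaussianPDF 0 _]
  simp [lintegral_gaussianPDF_eq_one 0 (Real.toNNReal_pos.2 hv).ne']

theorem gaussianPDFReal_mul_gaussianPDFReal_sub {s t : ℝ} (hs : 0 < s) (ht : 0 < t) (x z : ℝ) :
    gaussianPDFReal 0 s.toNNReal z * gaussianPDFReal 0 t.toNNReal (x - z) =
      gaussianPDFReal 0 (s + t).toNNReal x *
        gaussianPDFReal (s * x / (s + t)) (s * t / (s + t)).toNNReal z := by
  have hst : 0 < s + t := by positivity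
  have hst' : 0 < s * t / (s + t) := by positivity
  simp only [gaussianPDFReal, Real.coe_toNNReal _ hs.le, Real.coe_toNNReal _ ht.le,
    Real.coe_toNNReal _ hst.le, Real.coe_toNNReal _ hst'.le, sub_zero]
  rw [mul_mul_mul_comm, mul_mul_mul_comm (√(2 * π * (s + t)))⁻¹, ← Real.exp_add, ← Real.exp_add,
    ← mul_inv, ← mul_inv, ← Real.sqrt_mul (by positivity), ← Real.sqrt_mul (by positivity)]
  have hvar : 2 * π * s * (2 * π * t) = 2 * π * (s + t) * (2 * π * (s * t / (s + t))) := by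
    field_simp
  have hexp : -z ^ 2 / (2 * s) + -(x - z) ^ 2 / (2 * t) = -x ^ 2 / (2 * (s + t)) +
      -(z - s * x / (s + t)) ^ 2 / (2 * (s * t / (s + t))) := by
    field_simp
    ring
  rw [hvar, hexp]

theorem lintegral_piGaussian_mul_piGaussian_sub (d : ℕ) {s t : ℝ} (hs : 0 < s) (ht : 0 < t)
    (x : Fin d → ℝ) :
    ∫⁻ z, piGaussian d s z * piGaussian d t (x - z) = piGaussian d (s + t) x := by
  have hv : (s * t / (s + t)).toNNReal ≠ 0 := (Real.toNNReal_pos.2 (by positivity)).ne'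
  simp only [piGaussian, ← Finset.prod_mul_distrib, Pi.sub_apply]
  simp only [gaussianPDF, ← ENNReal.ofReal_mul (gaussianPDFReal_nonneg _ _ _),
    gaussianPDFReal_mul_gaussianPDFReal_sub hs ht]
  rw [lintegral_prod_eval_eq_prod_lintegral
    (f := fun i z => ENNReal.ofReal (gaussianPDFReal 0 (s + t).toNNReal (x i) *
        gaussianPDFReal (s * x i / (s + t)) (s * t / (s + t)).toNNReal z))
    (fun i => by fun_prop)]
  refine Finset.prod_congr rfl fun i _ => ?_
  simp only [ENNReal.ofReal_mul (gaussianPDFReal_nonneg _ _ _)]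
  rw [lintegral_const_mul _ (by fun_prop), lintegral_gaussianPDFReal_eq_one _ hv, mul_one]

theorem lintegral_Ioi_erlang_convolution (n : ℕ) {h : ℝ → ℝ≥0∞} (hh : Measurable h) :
    ∫⁻ s in Set.Ioi (0 : ℝ), ∫⁻ t in Set.Ioi (0 : ℝ), ENNReal.ofReal (exp (-s)) *
      (ENNReal.ofReal (exp (-t) * t ^ n / n.factorial) * h (s + t)) =
    ∫⁻ u in Set.Ioi (0 : ℝ), ENNReal.ofReal (exp (-u) * u ^ (n + 1) / (n + 1).factorial) * h u := by
  have hpow (u : ℝ) (hu : 0 < u) : ∫⁻ t in Set.Ioo 0 u, ENNReal.ofReal (t ^ n / n.factorial) =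
      ENNReal.ofReal (u ^ (n + 1) / (n + 1).factorial) := by
    rw [← ofReal_integral_eq_lintegral_ofReal]
    · rw [← integral_Ioc_eq_integral_Ioo, ← intervalIntegral.integral_of_le hu.le,
        intervalIntegral.integral_div, integral_pow, Nat.factorial_succ]
      congr 1
      push_cast
      field_simp
      simp
    · exact (Continuous.integrableOn_Icc (by fun_prop)).mono_set Set.Ioo_subset_Icc_self
    · filter_upwards [self_mem_ae_restrict measurableSet_Ioo] with t ht
      have := ht.1.le
      positivity
  rw [lintegral_lintegral_swap (by fun_prop)]
  have hinner (t : ℝ) (ht : 0 < t) : ∫⁻ s in Set.Ioi (0 : ℝ), ENNReal.ofReal (exp (-s)) *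
      (ENNReal.ofReal (exp (-t) * t ^ n / n.factorial) * h (s + t)) =
      ∫⁻ u in Set.Ioi (0 : ℝ), (Set.Ioi t).indicator (fun u => ENNReal.ofReal (t ^ n / n.factorial) *
        (ENNReal.ofReal (exp (-u)) * h u)) u := by
    rw [← lintegral_indicator measurableSet_Ioi, ← lintegral_indicator measurableSet_Ioi]
    conv_rhs => rw [← lintegral_add_right_eq_self _ t]
    refine lintegral_congr fun s => ?_
    by_cases hs : 0 < s
    · have hst : 0 < s + t := by positivity
      simp only [Set.indicator, Set.mem_Ioi, hs, hst, lt_add_iff_pos_left, if_true]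
      rw [← mul_assoc, ← mul_assoc, ← ENNReal.ofReal_mul (by positivity),
        ← ENNReal.ofReal_mul (by positivity)]
      congr 2
      rw [neg_add, Real.exp_add]
      ring
    · simp [Set.indicator, hs]
  rw [setLIntegral_congr_fun measurableSet_Ioi hinner, lintegral_lintegral_swap]
  · refine setLIntegral_congr_fun measurableSet_Ioi fun u hu => ?_
    have h1 : ∀ t, (Set.Ioi t).indicator (fun u => ENNReal.ofReal (t ^ n / n.factorial) *
        (ENNReal.ofReal (exp (-u)) * h u)) u = (Set.Iio u).indicator (fun t =>
          ENNReal.ofReal (t ^ n / n.factorial) * (ENNReal.ofReal (exp (-u)) * h u)) t := by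
      intro t; simp [Set.indicator]
    simp only [h1]
    rw [setLIntegral_indicator measurableSet_Iio, Set.inter_comm, Set.Ioi_inter_Iio,
      lintegral_mul_const _ (by fun_prop), hpow u hu, ← mul_assoc,
      ← ENNReal.ofReal_mul (by have : 0 < u := hu; positivity)]
    congr 2
    ring
  · have hset : MeasurableSet {p : ℝ × ℝ | p.1 < p.2} :=
      measurableSet_lt measurable_fst measurable_snd
    have : Measurable ({p : ℝ × ℝ | p.1 < p.2}.indicator fun p : ℝ × ℝ =>
        ENNReal.ofReal (p.1 ^ n / n.factorial) * (ENNReal.ofReal (exp (-p.2)) * h p.2)) :=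
      Measurable.indicator (by fun_prop) hset
    exact this.aemeasurable

theorem lintegral_Ioi_erlang (n : ℕ) :
    ∫⁻ t in Set.Ioi (0 : ℝ), ENNReal.ofReal (exp (-t) * t ^ n / n.factorial) = 1 := by
  have hG := Real.Gamma_eq_integral (s := n + 1) (by positivity)
  have hI := Real.GammaIntegral_convergent (s := n + 1) (by positivity)
  simp only [add_sub_cancel_right, Real.rpow_natCast] at hG hI
  rw [← ofReal_integral_eq_lintegral_ofReal]
  · rw [integral_div, ← hG, Real.Gamma_nat_eq_factorial, div_self (by positivity),
      ENNReal.ofReal_one]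
  · exact hI.div_const _
  · filter_upwards [self_mem_ae_restrict measurableSet_Ioi] with t ht
    have : 0 < t := ht
    positivity

theorem Kker_eq_lintegral_piGaussian (d : ℕ) (σ : ℝ) {μ : ℝ} (hμ : 0 < μ) (x : Fin d → ℝ) :
    Kker d σ μ x = ∫⁻ t in Set.Ioi (0 : ℝ),
      ENNReal.ofReal (exp (-t)) * piGaussian d (2 * μ ^ ((2 : ℝ) / σ) * t) x := by
  refine setLIntegral_congr_fun measurableSet_Ioi fun t (ht : 0 < t) => ?_
  have hc : 0 < 2 * μ ^ ((2 : ℝ) / σ) * t := by positivity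
  simp only [piGaussian, gaussianPDF, gaussianPDFReal, Real.coe_toNNReal _ hc.le, sub_zero]
  rw [← ENNReal.ofReal_prod_of_nonneg fun i _ => by positivity,
    ← ENNReal.ofReal_mul (by positivity), Finset.prod_mul_distrib, Finset.prod_const,
    Finset.card_univ, Fintype.card_fin, ← Real.exp_sum, ← Finset.sum_div, Finset.sum_neg_distrib,
    ← mul_assoc]
  have hv : 2 * π * (2 * μ ^ ((2 : ℝ) / σ) * t) = 4 * π * t * μ ^ ((2 : ℝ) / σ) := by ring
  have hv' : 2 * (2 * μ ^ ((2 : ℝ) / σ) * t) = 4 * t * μ ^ ((2 : ℝ) / σ) := by ring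
  rw [hv, hv', Real.sqrt_eq_rpow, ← Real.rpow_neg (by positivity), ← Real.rpow_natCast,
    ← Real.rpow_mul (by positivity)]
  congr 5
  ring

theorem kdens_eq_lintegral_piGaussian (d : ℕ) (σ : ℝ) {μ : ℝ} (hμ : 0 < μ) (n : ℕ)
    (x : Fin d → ℝ) :
    kdens d σ μ n x = ∫⁻ t in Set.Ioi (0 : ℝ), ENNReal.ofReal (exp (-t) * t ^ n / n.factorial) *
      piGaussian d (2 * μ ^ ((2 : ℝ) / σ) * t) x := by
  induction n generalizing x with
  | zero => simpa [kdens] using Kker_eq_lintegral_piGaussian d σ hμ x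
  | succ n ih =>
    have hc : 0 < 2 * μ ^ ((2 : ℝ) / σ) := by positivity
    simp only [kdens, ih, Kker_eq_lintegral_piGaussian d σ hμ]
    set c := 2 * μ ^ ((2 : ℝ) / σ)
    rw [← lintegral_Ioi_erlang_convolution n (h := fun u => piGaussian d (c * u) x) (by fun_prop)]
    calc
      _ = ∫⁻ z, ∫⁻ s in Set.Ioi (0 : ℝ), ∫⁻ t in Set.Ioi (0 : ℝ),
            ENNReal.ofReal (exp (-s)) * piGaussian d (c * s) z *
              (ENNReal.ofReal (exp (-t) * t ^ n / n.factorial) *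
                piGaussian d (c * t) (x - z)) := by
        refine lintegral_congr fun z => ?_
        rw [← lintegral_mul_const _ (by fun_prop)]
        refine lintegral_congr fun s => ?_
        rw [← lintegral_const_mul _ (by fun_prop)]
      _ = ∫⁻ s in Set.Ioi (0 : ℝ), ∫⁻ z, ∫⁻ t in Set.Ioi (0 : ℝ),
            ENNReal.ofReal (exp (-s)) * piGaussian d (c * s) z *
              (ENNReal.ofReal (exp (-t) * t ^ n / n.factorial) *
                piGaussian d (c * t) (x - z)) := by
        refine lintegral_lintegral_swap (Measurable.aemeasurable ?_)
        exact Measurable.lintegral_prod_right (by fun_prop)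
      _ = _ := by
        refine setLIntegral_congr_fun measurableSet_Ioi fun s (hs : 0 < s) => ?_
        rw [lintegral_lintegral_swap (by fun_prop)]
        refine setLIntegral_congr_fun measurableSet_Ioi fun t (ht : 0 < t) => ?_
        rw [mul_add, ← lintegral_piGaussian_mul_piGaussian_sub d (mul_pos hc hs) (mul_pos hc ht),
          ← lintegral_const_mul _ (by fun_prop), ← lintegral_const_mul _ (by fun_prop)]
        refine lintegral_congr fun z => ?_
        ring

theorem measurable_kdens (d : ℕ) (σ : ℝ) {μ : ℝ} (hμ : 0 < μ) (n : ℕ) :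
    Measurable (kdens d σ μ n) := by
  rw [funext (kdens_eq_lintegral_piGaussian d σ hμ n)]
  exact Measurable.lintegral_prod_right (by fun_prop)

theorem lintegral_kdens (d : ℕ) (σ : ℝ) {μ : ℝ} (hμ : 0 < μ) (n : ℕ) :
    ∫⁻ x, kdens d σ μ n x = 1 := by
  simp only [kdens_eq_lintegral_piGaussian d σ hμ n]
  rw [lintegral_lintegral_swap (by fun_prop), ← lintegral_Ioi_erlang n]
  refine setLIntegral_congr_fun measurableSet_Ioi fun t (ht : 0 < t) => ?_
  rw [lintegral_const_mul _ (by fun_prop), lintegral_piGaussian d (by positivity), mul_one]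

theorem lintegral_box_tsum_translate_le {d : ℕ} {f : (Fin d → ℝ) → ℝ≥0∞} (hf : Measurable f) :
    ∫⁻ x in box d, ∑' k : Fin d → ℤ, f (x + fun i => 2 * π * (k i : ℝ)) ≤ ∫⁻ x, f x := by
  have hbox : MeasurableSet (box d) := MeasurableSet.univ_pi fun _ => measurableSet_Ico
  let a : (Fin d → ℤ) → Fin d → ℝ := fun k i => 2 * π * (k i : ℝ)
  have hmeas (k : Fin d → ℤ) : MeasurableSet ((fun y => y - a k) ⁻¹' box d) :=
    hbox.preimage (by fun_prop)
  rw [lintegral_tsum fun k => by fun_prop]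
  have htranslate (k : Fin d → ℤ) :
      ∫⁻ x in box d, f (x + a k) = ∫⁻ y in (fun y => y - a k) ⁻¹' box d, f y := by
    rw [← (measurePreserving_add_right volume (a k)).setLIntegral_comp_preimage (hmeas k) hf]
    congr 2
    ext x
    simp
  have hdisj : Pairwise (Function.onFun Disjoint fun k => (fun y => y - a k) ⁻¹' box d) := by
    intro k l hkl
    refine Set.disjoint_left.2 fun y hk hl => hkl (funext fun i => ?_)
    have hki := hk i (Set.mem_univ i)
    have hli := hl i (Set.mem_univ i)
    simp only [Pi.sub_apply, a, Set.mem_Ico] at hki hli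
    have hpi := Real.pi_pos
    have h1 : (k i : ℝ) < l i + 1 := by
      by_contra! h
      nlinarith
    have h2 : (l i : ℝ) < k i + 1 := by
      by_contra! h
      nlinarith
    have h1' : k i < l i + 1 := by exact_mod_cast h1
    have h2' : l i < k i + 1 := by exact_mod_cast h2
    omega
  calc ∑' k, ∫⁻ x in box d, f (x + a k)
      = ∫⁻ y in ⋃ k, (fun y => y - a k) ⁻¹' box d, f y := by
        rw [lintegral_iUnion hmeas hdisj]
        exact tsum_congr htranslate
    _ ≤ ∫⁻ y, f y := setLIntegral_le_lintegral _ _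

theorem tsum_gaussianPDF_translate_le {v : ℝ} (hv : 0 < v) {x : ℝ}
    (hx : x ∈ Set.Ico 0 (2 * π)) :
    ∑' k : ℤ, gaussianPDF 0 v.toNNReal (x + 2 * π * k) ≤ ENNReal.ofReal (6 * (1 + (√v)⁻¹)) := by
  have hw : 0 < √v := Real.sqrt_pos.2 hv
  have hpi := Real.pi_gt_three
  set w := √v with hw_def
  have hwv : w ^ 2 = v := Real.sq_sqrt hv.le
  have hr1 : exp (-2 / w) < 1 := by
    rw [Real.exp_lt_one_iff]
    exact div_neg_of_neg_of_pos (by norm_num) hw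
  have hterm (n : ℕ) (y : ℝ) (hy : (2 * π * n) ^ 2 ≤ y ^ 2) :
      gaussianPDF 0 v.toNNReal y ≤ ENNReal.ofReal (w⁻¹ * 3 * exp (-2 / w) ^ n) := by
    refine ENNReal.ofReal_le_ofReal ?_
    rw [gaussianPDFReal, Real.coe_toNNReal _ hv.le, sub_zero]
    have hsqrt : (√(2 * π * v))⁻¹ ≤ w⁻¹ := by
      gcongr
      exact Real.sqrt_le_sqrt (by nlinarith)
    have hquad : -y ^ 2 / (2 * v) ≤ 1 + n * (-2 / w) := by
      have h1 : (n / w) ^ 2 ≤ y ^ 2 / (2 * v) := by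
        rw [div_pow, hwv, div_le_div_iff₀ hv (by positivity)]
        have : 2 * (n : ℝ) ^ 2 ≤ y ^ 2 := by
          refine le_trans ?_ hy
          rw [mul_pow]
          gcongr
          nlinarith
        nlinarith
      have h2 : (n : ℝ) * (-2 / w) = -2 * (n / w) := by ring
      rw [h2, neg_div]
      nlinarith [sq_nonneg ((n : ℝ) / w - 1)]
    have hexp : exp (-y ^ 2 / (2 * v)) ≤ 3 * exp (-2 / w) ^ n := by
      rw [← Real.exp_nat_mul]
      refine (Real.exp_le_exp.2 hquad).trans ?_
      rw [Real.exp_add]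
      gcongr
      linarith [Real.exp_one_lt_d9]
    rw [mul_assoc w⁻¹]
    exact mul_le_mul hsqrt hexp (by positivity) (by positivity)
  have hgeom : ∑' n : ℕ, ENNReal.ofReal (w⁻¹ * 3 * exp (-2 / w) ^ n) ≤
      ENNReal.ofReal (3 * (1 + w⁻¹)) := by
    rw [← ENNReal.ofReal_tsum_of_nonneg (fun n => by positivity)
      ((summable_geometric_of_lt_one (by positivity) hr1).mul_left _), tsum_mul_left,
      tsum_geometric_of_lt_one (by positivity) hr1]
    refine ENNReal.ofReal_le_ofReal ?_
    have h1 : (1 - exp (-2 / w))⁻¹ ≤ 1 + w := by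
      rw [inv_le_comm₀ (by linarith) (by positivity)]
      have h2 : exp (-2 / w) ≤ (1 + w⁻¹)⁻¹ := by
        rw [neg_div, Real.exp_neg]
        gcongr
        have := Real.add_one_le_exp (2 / w)
        have h3 : 2 / w = 2 * w⁻¹ := by ring
        have : 0 < w⁻¹ := by positivity
        linarith
      have h4 : (1 + w)⁻¹ = 1 - (1 + w⁻¹)⁻¹ := by
        field_simp
        ring
      linarith
    calc w⁻¹ * 3 * (1 - exp (-2 / w))⁻¹ ≤ w⁻¹ * 3 * (1 + w) := by gcongr
      _ = 3 * (1 + w⁻¹) := by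
        field_simp
        ring
  rw [tsum_of_nat_of_neg_add_one ENNReal.summable ENNReal.summable]
  calc _ ≤ ENNReal.ofReal (3 * (1 + w⁻¹)) + ENNReal.ofReal (3 * (1 + w⁻¹)) := by
        refine add_le_add ((ENNReal.tsum_le_tsum fun n => hterm n _ ?_).trans hgeom)
          ((ENNReal.tsum_le_tsum fun n => hterm n _ ?_).trans hgeom)
        · push_cast
          have := hx.1
          gcongr
          linarith
        · push_cast
          rw [← neg_sq (x + _)]
          have := hx.2
          gcongr
          linarith
    _ = ENNReal.ofReal (6 * (1 + w⁻¹)) := by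
        rw [← ENNReal.ofReal_add (by positivity) (by positivity)]
        congr 1
        ring

theorem lintegral_Ioi_erlang_mul_one_add_inv_sqrt_pow_lt_top {d : ℕ} (hd : 1 ≤ d) :
    ∫⁻ t in Set.Ioi (0 : ℝ), ENNReal.ofReal (exp (-t) * t ^ (d - 1) / (d - 1).factorial) *
      ENNReal.ofReal ((6 * (1 + (√t)⁻¹)) ^ d) < ∞ := by
  have hd0 : (0 : ℝ) < d := by exact_mod_cast hd
  have hI := ((Real.GammaIntegral_convergent (s := d) hd0).add
    (Real.GammaIntegral_convergent (s := d / 2) (by positivity))).const_mul (6 ^ d * 2 ^ (d - 1))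
  refine lt_of_le_of_lt ?_ hI.lintegral_lt_top
  refine setLIntegral_mono' measurableSet_Ioi fun t (ht : 0 < t) => ?_
  rw [← ENNReal.ofReal_mul (by positivity)]
  refine ENNReal.ofReal_le_ofReal ?_
  have hpow : t ^ ((d : ℝ) - 1) = t ^ (d - 1) := by
    rw [← Real.rpow_natCast, Nat.cast_sub hd, Nat.cast_one]
  have hhalf : t ^ ((d : ℝ) / 2 - 1) = t ^ (d - 1) * (√t)⁻¹ ^ d := by
    rw [← hpow, Real.sqrt_eq_rpow, ← Real.rpow_neg ht.le, ← Real.rpow_natCast (t ^ _),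
      ← Real.rpow_mul ht.le, ← Real.rpow_add ht]
    congr 1
    ring
  have hadd : (1 + (√t)⁻¹) ^ d ≤ 2 ^ (d - 1) * (1 + (√t)⁻¹ ^ d) := by
    simpa using add_pow_le zero_le_one (inv_nonneg.2 (Real.sqrt_nonneg t)) d
  have hfact : exp (-t) * t ^ (d - 1) / (d - 1).factorial ≤ exp (-t) * t ^ (d - 1) :=
    div_le_self (by positivity)
      (by exact_mod_cast Nat.one_le_iff_ne_zero.2 (Nat.factorial_ne_zero _))
  simp only [Pi.add_apply]
  rw [hpow, hhalf, mul_pow]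
  calc _ ≤ exp (-t) * t ^ (d - 1) * (6 ^ d * (2 ^ (d - 1) * (1 + (√t)⁻¹ ^ d))) := by gcongr
    _ = _ := by ring

theorem tsum_piGaussian_translate_le {d : ℕ} {v : ℝ} (hv : 0 < v) {x : Fin d → ℝ}
    (hx : x ∈ box d) :
    ∑' k : Fin d → ℤ, piGaussian d v (x + fun i => 2 * π * (k i : ℝ)) ≤
      ENNReal.ofReal ((6 * (1 + (√v)⁻¹)) ^ d) := by
  calc _ ≤ ∏ i, ∑' k : ℤ, gaussianPDF 0 v.toNNReal (x i + 2 * π * k) :=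
        ENNReal.tsum_pi_prod_le fun i (k : ℤ) => gaussianPDF 0 v.toNNReal (x i + 2 * π * k)
    _ ≤ ∏ _i : Fin d, ENNReal.ofReal (6 * (1 + (√v)⁻¹)) :=
        Finset.prod_le_prod' fun i _ => tsum_gaussianPDF_translate_le hv (hx i (Set.mem_univ i))
    _ = _ := by simp [ENNReal.ofReal_pow (show 0 ≤ 6 * (1 + (√v)⁻¹) by positivity)]

theorem exists_perKd_le {d : ℕ} (hd : 1 ≤ d) {σ : ℝ} (hσ : 0 < σ) :
    ∃ M : ℝ, 0 < M ∧ ∀ μ ∈ Set.Ioc (0 : ℝ) 1, ∀ x ∈ box d,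
      perKd d σ μ x ≤ ENNReal.ofReal (M * μ ^ (-(d : ℝ) / σ)) := by
  have hJ := lintegral_Ioi_erlang_mul_one_add_inv_sqrt_pow_lt_top hd
  set J := ∫⁻ t in Set.Ioi (0 : ℝ), ENNReal.ofReal (exp (-t) * t ^ (d - 1) / (d - 1).factorial) *
      ENNReal.ofReal ((6 * (1 + (√t)⁻¹)) ^ d)
  refine ⟨J.toReal + 1, by positivity, fun μ hμ x hx => ?_⟩
  obtain ⟨hμ0, hμ1⟩ := hμ
  set m := μ ^ (1 / σ) with hm_def
  have hm : 0 < m := by positivity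
  have hm1 : m ≤ 1 := Real.rpow_le_one hμ0.le hμ1 (by positivity)
  have hm2 : μ ^ ((2 : ℝ) / σ) = m ^ 2 := by
    rw [hm_def, ← Real.rpow_natCast, ← Real.rpow_mul hμ0.le]
    congr 1
    push_cast
    ring
  have hmd : μ ^ (-(d : ℝ) / σ) = m⁻¹ ^ d := by
    rw [hm_def, ← Real.rpow_neg hμ0.le, ← Real.rpow_natCast, ← Real.rpow_mul hμ0.le]
    congr 1
    ring
  have hscale (t : ℝ) (ht : 0 < t) : (6 * (1 + (√(2 * m ^ 2 * t))⁻¹)) ^ d ≤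
      m⁻¹ ^ d * (6 * (1 + (√t)⁻¹)) ^ d := by
    have h1 : (√(2 * m ^ 2 * t))⁻¹ ≤ m⁻¹ * (√t)⁻¹ := by
      rw [← mul_inv]
      gcongr
      refine Real.le_sqrt_of_sq_le ?_
      rw [mul_pow, Real.sq_sqrt ht.le]
      nlinarith [mul_pos (pow_pos hm 2) ht]
    have h2 : 1 ≤ m⁻¹ := (one_le_inv₀ hm).2 hm1
    rw [← mul_pow, mul_left_comm]
    gcongr
    linarith
  simp only [perKd, kdens_eq_lintegral_piGaussian d σ hμ0, hm2, hmd]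
  rw [← lintegral_tsum fun k => by fun_prop]
  calc _ ≤ ∫⁻ t in Set.Ioi (0 : ℝ), ENNReal.ofReal (m⁻¹ ^ d) *
        (ENNReal.ofReal (exp (-t) * t ^ (d - 1) / (d - 1).factorial) *
          ENNReal.ofReal ((6 * (1 + (√t)⁻¹)) ^ d)) := by
        refine setLIntegral_mono' measurableSet_Ioi fun t (ht : 0 < t) => ?_
        rw [ENNReal.tsum_mul_left, mul_left_comm]
        gcongr
        rw [← ENNReal.ofReal_mul (by positivity)]
        exact (tsum_piGaussian_translate_le (by positivity) hx).trans
          (ENNReal.ofReal_le_ofReal (hscale t ht))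
    _ = ENNReal.ofReal (m⁻¹ ^ d) * J := lintegral_const_mul _ (by fun_prop)
    _ = ENNReal.ofReal (m⁻¹ ^ d) * ENNReal.ofReal J.toReal := by rw [ENNReal.ofReal_toReal hJ.ne]
    _ ≤ ENNReal.ofReal ((J.toReal + 1) * m⁻¹ ^ d) := by
        rw [mul_comm, ← ENNReal.ofReal_mul (by positivity)]
        refine ENNReal.ofReal_le_ofReal ?_
        gcongr
        linarith

theorem lintegral_box_perKd_le (d : ℕ) (σ : ℝ) {μ : ℝ} (hμ : 0 < μ) :
    ∫⁻ x in box d, perKd d σ μ x ≤ 1 :=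
  (lintegral_box_tsum_translate_le (measurable_kdens d σ hμ (d - 1))).trans_eq
    (lintegral_kdens d σ hμ (d - 1))

theorem setLIntegral_rpow_rpow_inv_le {α : Type*} [MeasurableSpace α] {ν : Measure α} {s : Set α}
    (hs : MeasurableSet s) {f : α → ℝ≥0∞} {B : ℝ} (hB : 0 < B)
    (hfB : ∀ x ∈ s, f x ≤ ENNReal.ofReal B) (hf : ∫⁻ x in s, f x ∂ν ≤ 1) {p : ℝ} (hp : 1 ≤ p) :
    (∫⁻ x in s, f x ^ p ∂ν) ^ (1 / p) ≤ ENNReal.ofReal (B ^ ((p - 1) / p)) := by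
  have hp0 : 0 < p := by linarith
  have hint : ∫⁻ x in s, f x ^ p ∂ν ≤ ENNReal.ofReal (B ^ (p - 1)) := by
    calc _ ≤ ∫⁻ x in s, ENNReal.ofReal (B ^ (p - 1)) * f x ∂ν := by
          refine setLIntegral_mono' hs fun x hx => ?_
          have hsplit : f x ^ p = f x ^ (p - 1) * f x := by
            conv_lhs => rw [← sub_add_cancel p 1,
              ENNReal.rpow_add_of_nonneg _ _ (by linarith) zero_le_one, ENNReal.rpow_one]
          rw [hsplit, ← ENNReal.ofReal_rpow_of_pos hB]
          gcongr
          exact hfB x hx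
      _ = ENNReal.ofReal (B ^ (p - 1)) * ∫⁻ x in s, f x ∂ν :=
          lintegral_const_mul' _ _ ENNReal.ofReal_ne_top
      _ ≤ _ := mul_le_of_le_one_right' hf
  calc _ ≤ ENNReal.ofReal (B ^ (p - 1)) ^ (1 / p) := by gcongr
    _ = _ := by
      rw [ENNReal.ofReal_rpow_of_pos (by positivity), ← Real.rpow_mul hB.le, mul_one_div]

/-- `‖𝐓(K_μ^{*d})‖_{L^p(𝕋)} ≤ C [μ]^{−d(p−1)/p}` for `p ∈ [1,∞)` and
`‖𝐓(K_μ^{*d})‖_{L^∞(𝕋)} ≤ C [μ]^{−d}`, uniformly in `μ ∈ (0,1]`. -/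
theorem stmt7 (d : ℕ) (hd : 1 ≤ d) (σ : ℝ) (hσ : 0 < σ) :
    (∀ p : ℝ, 1 ≤ p → ∃ C : ℝ, 0 < C ∧ ∀ μ : ℝ, μ ∈ Set.Ioc (0 : ℝ) 1 →
      (∫⁻ x in box d, perKd d σ μ x ^ p) ^ (1 / p) ≤
        ENNReal.ofReal (C * μ ^ (-((d : ℝ) * (p - 1)) / (p * σ)))) ∧
    (∃ C : ℝ, 0 < C ∧ ∀ μ : ℝ, μ ∈ Set.Ioc (0 : ℝ) 1 →
      essSup (perKd d σ μ) (volume.restrict (box d)) ≤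
        ENNReal.ofReal (C * μ ^ (-(d : ℝ) / σ))) := by
  obtain ⟨M, hM, hbound⟩ := exists_perKd_le hd hσ
  have hbox : MeasurableSet (box d) := MeasurableSet.univ_pi fun _ => measurableSet_Ico
  refine ⟨fun p hp => ⟨M ^ ((p - 1) / p), by positivity, fun μ hμ => ?_⟩, M, hM, fun μ hμ => ?_⟩
  · have hμ0 : 0 < μ := hμ.1
    refine (setLIntegral_rpow_rpow_inv_le hbox (by positivity) (hbound μ hμ)
      (lintegral_box_perKd_le d σ hμ0) hp).trans_eq ?_
    rw [Real.mul_rpow hM.le (by positivity), ← Real.rpow_mul hμ0.le]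
    congr 3
    have : p ≠ 0 := by positivity
    field_simp
  · exact essSup_le_of_ae_le _ (ae_restrict_of_forall_mem hbox (hbound μ hμ))
end

section
/- For every x ∈ ℝ^d \ {0} the map μ ↦ K_μ(x) is differentiable on (0,∞); its derivative ∂_μ K_μ belongs to L^1(ℝ^d) for every μ > 0, and there exists a constant C = C(d, σ) > 0 such that ‖∂_μ K_μ‖_{L^1(ℝ^d)} ≤ C [μ]^{−σ} = C μ^{−1} for all μ > 0. -/
open MeasureTheory ENNReal Real

/-- The radial profile of the heat kernel at time `τ`, as a function of the squared radius `r`. -/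
noncomputable def heatProfile (d : ℕ) (τ r : ℝ) : ℝ :=
  (4 * π * τ) ^ (-(d : ℝ) / 2) * Real.exp (-r / (4 * τ))

lemma heatProfile_nonneg (d : ℕ) {τ : ℝ} (hτ : 0 < τ) (r : ℝ) : 0 ≤ heatProfile d τ r := by
  unfold heatProfile
  positivity

lemma hasDerivAt_heatProfile (d : ℕ) {τ : ℝ} (hτ : 0 < τ) (r : ℝ) :
    HasDerivAt (fun τ => heatProfile d τ r)
      (heatProfile d τ r * (r / (4 * τ) - d / 2) / τ) τ := by
  have h1 : HasDerivAt (fun τ : ℝ => 4 * π * τ) (4 * π) τ := by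
    simpa using (hasDerivAt_id τ).const_mul (4 * π)
  have h2 := h1.rpow_const (p := -(d : ℝ) / 2) (Or.inl (by positivity))
  have h3 : HasDerivAt (fun τ : ℝ => 4 * τ) 4 τ := by
    simpa using (hasDerivAt_id τ).const_mul 4
  have h4 := (((hasDerivAt_const τ (-r)).div h3 (by positivity))).exp
  refine (h2.mul h4).congr_deriv ?_
  have hpos : 0 < 4 * π * τ := by positivity
  rw [Real.rpow_sub_one hpos.ne']
  simp only [heatProfile, Pi.div_apply]
  field_simp
  ring

/-- For `r > 0` the heat profile is bounded uniformly in time. -/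
lemma heatProfile_le {d : ℕ} (hd : 1 ≤ d) {τ r : ℝ} (hτ : 0 < τ) (hr : 0 < r) :
    heatProfile d τ r ≤ (2 * π * r / d) ^ (-(d : ℝ) / 2) := by
  have hd' : (0 : ℝ) < d := by exact_mod_cast hd
  set y : ℝ := r / (2 * d * τ) with hy
  have hy0 : 0 < y := by positivity
  have e1 : 4 * π * τ = (2 * π * r / d) * y⁻¹ := by
    rw [hy]; field_simp; ring
  have e2 : -r / (4 * τ) = y * (-(d : ℝ) / 2) := by
    rw [hy]; field_simp; ring
  have e3 : (y⁻¹) ^ (-(d : ℝ) / 2) = y ^ ((d : ℝ) / 2) := by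
    rw [Real.inv_rpow hy0.le, ← Real.rpow_neg hy0.le]
    congr 1; ring
  have hle : y ^ ((d : ℝ) / 2) ≤ Real.exp (y * ((d : ℝ) / 2)) := by
    rw [Real.exp_mul]
    have : y ≤ Real.exp y := by linarith [Real.add_one_le_exp y]
    gcongr
  unfold heatProfile
  rw [e2, e1, Real.mul_rpow (by positivity) (by positivity), e3, mul_assoc]
  refine mul_le_of_le_one_right (by positivity) ?_
  calc y ^ ((d : ℝ) / 2) * Real.exp (y * (-(d : ℝ) / 2))
      ≤ Real.exp (y * ((d : ℝ) / 2)) * Real.exp (y * (-(d : ℝ) / 2)) := by gcongr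
    _ = 1 := by rw [← Real.exp_add, ← Real.exp_zero]; congr 1; ring

/-- The polynomial factor of the time derivative is absorbed by half of the Gaussian. -/
lemma abs_heatProfile_mul_le (d : ℕ) {τ r : ℝ} (hτ : 0 < τ) (hr : 0 ≤ r) :
    |heatProfile d τ r * (r / (4 * τ) - d / 2)| ≤ (2 + d / 2) * heatProfile d τ (r / 2) := by
  set u : ℝ := r / (4 * τ) with hu
  have hu0 : 0 ≤ u := by positivity
  have e1 : -r / (4 * τ) = -(u / 2) + -(u / 2) := by rw [hu]; ring
  have e2 : -(r / 2) / (4 * τ) = -(u / 2) := by rw [hu]; ring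
  have habs : |u - d / 2| ≤ u + d / 2 := by
    rw [abs_le]
    constructor <;> linarith [show (0 : ℝ) ≤ d / 2 by positivity]
  have hexp : Real.exp (-(u / 2)) * (u + d / 2) ≤ 2 + d / 2 := by
    have h1 : Real.exp (-(u / 2)) * u ≤ 2 := by
      rw [Real.exp_neg, inv_mul_le_iff₀ (Real.exp_pos _)]
      linarith [Real.add_one_le_exp (u / 2)]
    have h2 : Real.exp (-(u / 2)) * (d / 2) ≤ d / 2 :=
      mul_le_of_le_one_left (by positivity) (Real.exp_le_one_iff.2 (by linarith))
    linarith
  rw [abs_mul, abs_of_nonneg (heatProfile_nonneg d hτ r)]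
  unfold heatProfile
  rw [e1, e2, Real.exp_add]
  have hc : 0 ≤ (4 * π * τ) ^ (-(d : ℝ) / 2) * Real.exp (-(u / 2)) := by positivity
  calc (4 * π * τ) ^ (-(d : ℝ) / 2) * (Real.exp (-(u / 2)) * Real.exp (-(u / 2))) * |u - d / 2|
      = ((4 * π * τ) ^ (-(d : ℝ) / 2) * Real.exp (-(u / 2))) *
          (Real.exp (-(u / 2)) * |u - d / 2|) := by ring
    _ ≤ ((4 * π * τ) ^ (-(d : ℝ) / 2) * Real.exp (-(u / 2))) *
          (Real.exp (-(u / 2)) * (u + d / 2)) := by gcongr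
    _ ≤ ((4 * π * τ) ^ (-(d : ℝ) / 2) * Real.exp (-(u / 2))) * (2 + d / 2) := by gcongr
    _ = _ := by ring

lemma heatProfile_half (d : ℕ) {τ : ℝ} (hτ : 0 < τ) (r : ℝ) :
    heatProfile d τ (r / 2) = 2 ^ ((d : ℝ) / 2) * heatProfile d (2 * τ) r := by
  unfold heatProfile
  have e : 4 * π * (2 * τ) = 2 * (4 * π * τ) := by ring
  have e2 : -(r / 2) / (4 * τ) = -r / (4 * (2 * τ)) := by field_simp
  have hpos : 0 ≤ 4 * π * τ := by positivity
  rw [e, Real.mul_rpow zero_le_two hpos, ← mul_assoc, ← mul_assoc,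
    ← Real.rpow_add zero_lt_two, e2]
  have : (d : ℝ) / 2 + -(d : ℝ) / 2 = 0 := by ring
  rw [this, Real.rpow_zero, one_mul]

/-- The heat kernel has mass one. -/
lemma lintegral_heatProfile (d : ℕ) {τ : ℝ} (hτ : 0 < τ) :
    ∫⁻ x : Fin d → ℝ, ENNReal.ofReal (heatProfile d τ (∑ i, x i ^ 2)) = 1 := by
  have hb : 0 < (4 * τ)⁻¹ := by positivity
  have hfun : (fun x : Fin d → ℝ => heatProfile d τ (∑ i, x i ^ 2)) =
      fun x => (4 * π * τ) ^ (-(d : ℝ) / 2) * ∏ i, Real.exp (-(4 * τ)⁻¹ * x i ^ 2) := by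
    funext x
    unfold heatProfile
    rw [← Real.exp_sum, ← Finset.mul_sum]
    congr 2
    ring
  have hint : Integrable (fun x : Fin d → ℝ => heatProfile d τ (∑ i, x i ^ 2)) := by
    rw [hfun]
    exact (Integrable.fintype_prod (f := fun (_ : Fin d) (y : ℝ) => Real.exp (-(4 * τ)⁻¹ * y ^ 2))
      (fun _ => integrable_exp_neg_mul_sq hb)).const_mul _
  rw [← ofReal_integral_eq_lintegral_ofReal hint
    (Filter.Eventually.of_forall fun x => heatProfile_nonneg d hτ _), hfun, integral_const_mul,
    integral_fintype_prod_volume_eq_pow (fun y : ℝ => Real.exp (-(4 * τ)⁻¹ * y ^ 2)),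
    integral_gaussian, Fintype.card_fin, ← ENNReal.ofReal_one]
  congr 1
  have hpos : 0 < 4 * π * τ := by positivity
  have e : π / (4 * τ)⁻¹ = 4 * π * τ := by field_simp
  rw [e, Real.sqrt_eq_rpow, ← Real.rpow_mul_natCast hpos.le, ← Real.rpow_add hpos]
  convert Real.rpow_zero (4 * π * τ) using 2
  ring

lemma KkerR_eq (d : ℕ) (σ μ : ℝ) (x : Fin d → ℝ) :
    KkerR d σ μ x = ∫ t in Set.Ioi (0 : ℝ),
      Real.exp (-t) * heatProfile d (t * μ ^ ((2 : ℝ) / σ)) (∑ i, x i ^ 2) := by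
  simp only [KkerR, heatProfile, mul_assoc]

/-- The `μ`-derivative of the integrand in the subordination formula. -/
noncomputable def subordinatedDeriv (d : ℕ) (σ μ r t : ℝ) : ℝ :=
  Real.exp (-t) * (heatProfile d (t * μ ^ ((2 : ℝ) / σ)) r *
    (r / (4 * (t * μ ^ ((2 : ℝ) / σ))) - d / 2)) * (2 / (σ * μ))

lemma measurable_subordinatedDeriv (d : ℕ) (σ μ : ℝ) :
    Measurable (fun p : ℝ × ℝ => subordinatedDeriv d σ μ p.1 p.2) := by
  unfold subordinatedDeriv heatProfile
  fun_prop

lemma measurable_subordinatedDeriv_sq (d : ℕ) (σ μ : ℝ) :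
    Measurable (fun p : (Fin d → ℝ) × ℝ => subordinatedDeriv d σ μ (∑ i, p.1 i ^ 2) p.2) := by
  have hsq : Measurable (fun p : (Fin d → ℝ) × ℝ => ∑ i, p.1 i ^ 2) :=
    Finset.measurable_sum _ fun i _ => by fun_prop
  exact (measurable_subordinatedDeriv d σ μ).comp (hsq.prodMk measurable_snd)

lemma hasDerivAt_integrand (d : ℕ) {σ μ t : ℝ} (hμ : 0 < μ) (ht : 0 < t) (hσ : 0 < σ) (r : ℝ) :
    HasDerivAt (fun ν => Real.exp (-t) * heatProfile d (t * ν ^ ((2 : ℝ) / σ)) r)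
      (subordinatedDeriv d σ μ r t) μ := by
  have h1 := ((hasDerivAt_id μ).rpow_const (p := (2 : ℝ) / σ) (Or.inl hμ.ne')).const_mul t
  have hs : 0 < t * μ ^ ((2 : ℝ) / σ) := by positivity
  have h2 := ((hasDerivAt_heatProfile d hs r).comp μ h1).const_mul (Real.exp (-t))
  refine h2.congr_deriv ?_
  simp only [id, subordinatedDeriv]
  rw [Real.rpow_sub_one hμ.ne']
  have : 0 < μ ^ ((2 : ℝ) / σ) := by positivity
  generalize μ ^ ((2 : ℝ) / σ) = s at *
  generalize heatProfile d (t * s) r = h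
  field_simp

lemma abs_subordinatedDeriv_le (d : ℕ) {σ μ t r : ℝ} (hμ : 0 < μ) (ht : 0 < t) (hσ : 0 < σ)
    (hr : 0 ≤ r) :
    |subordinatedDeriv d σ μ r t| ≤
      Real.exp (-t) * ((2 + d / 2) * heatProfile d (t * μ ^ ((2 : ℝ) / σ)) (r / 2)) *
        (2 / (σ * μ)) := by
  have hs : 0 < t * μ ^ ((2 : ℝ) / σ) := by positivity
  unfold subordinatedDeriv
  rw [abs_mul, abs_mul, abs_of_pos (Real.exp_pos _), abs_of_pos (show 0 < 2 / (σ * μ) by positivity)]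
  gcongr
  exact abs_heatProfile_mul_le d hs hr

lemma hasDerivAt_KkerR {d : ℕ} (hd : 1 ≤ d) {σ μ : ℝ} (hσ : 0 < σ) (hμ : 0 < μ)
    {x : Fin d → ℝ} (hx : x ≠ 0) :
    HasDerivAt (fun ν => KkerR d σ ν x)
      (∫ t in Set.Ioi (0 : ℝ), subordinatedDeriv d σ μ (∑ i, x i ^ 2) t) μ := by
  have hr : 0 < ∑ i, x i ^ 2 := by
    obtain ⟨i, hi⟩ := Function.ne_iff.1 hx
    exact Finset.sum_pos' (fun _ _ => sq_nonneg _) ⟨i, Finset.mem_univ i, sq_pos_of_ne_zero hi⟩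
  set r := ∑ i, x i ^ 2
  simp only [KkerR_eq]
  have hmeas : ∀ ν : ℝ, Measurable
      (fun t => Real.exp (-t) * heatProfile d (t * ν ^ ((2 : ℝ) / σ)) r) := by
    intro ν
    unfold heatProfile
    fun_prop
  have hexp : Integrable (fun t : ℝ => Real.exp (-t)) (volume.restrict (Set.Ioi 0)) :=
    integrableOn_exp_neg_Ioi 0
  refine (hasDerivAt_integral_of_dominated_loc_of_deriv_le
    (s := Set.Ioi (μ / 2)) (F' := fun ν t => subordinatedDeriv d σ ν r t)
    (bound := fun t => Real.exp (-t) * (((2 + d / 2) * (2 * π * (r / 2) / d) ^ (-(d : ℝ) / 2)) *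
        (2 / (σ * (μ / 2)))))
    (Ioi_mem_nhds (by linarith)) ?_ ?_ ?_ ?_ ?_ ?_).2
  · exact Filter.Eventually.of_forall fun ν => (hmeas ν).aestronglyMeasurable
  · refine (hexp.mul_const ((2 * π * r / d) ^ (-(d : ℝ) / 2))).mono'
      (hmeas μ).aestronglyMeasurable ?_
    filter_upwards [ae_restrict_mem measurableSet_Ioi] with t ht
    have ht : 0 < t := ht
    have hs : 0 < t * μ ^ ((2 : ℝ) / σ) := by positivity
    rw [Real.norm_of_nonneg (mul_nonneg (Real.exp_pos _).le (heatProfile_nonneg d hs r))]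
    gcongr
    exact heatProfile_le hd hs hr
  · exact ((measurable_subordinatedDeriv d σ μ).comp
      (measurable_const.prodMk measurable_id)).aestronglyMeasurable
  · filter_upwards [ae_restrict_mem measurableSet_Ioi] with t ht ν hν
    have ht : 0 < t := ht
    have hν' : μ / 2 < ν := hν
    have hν0 : 0 < ν := by linarith
    have hs : 0 < t * ν ^ ((2 : ℝ) / σ) := by positivity
    rw [Real.norm_eq_abs]
    refine (abs_subordinatedDeriv_le d hν0 ht hσ hr.le).trans ?_
    rw [mul_assoc]
    gcongr
    exact heatProfile_le hd hs (by positivity)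
  · exact hexp.mul_const _
  · filter_upwards [ae_restrict_mem measurableSet_Ioi] with t ht ν hν
    have hν' : μ / 2 < ν := hν
    exact hasDerivAt_integrand d (by linarith) ht hσ r

lemma lintegral_subordinatedDeriv_le (d : ℕ) {σ μ : ℝ} (hσ : 0 < σ) (hμ : 0 < μ) :
    ∫⁻ x : Fin d → ℝ, ∫⁻ t in Set.Ioi (0 : ℝ), ‖subordinatedDeriv d σ μ (∑ i, x i ^ 2) t‖ₑ ≤
      ENNReal.ofReal ((2 + d / 2) * 2 ^ ((d : ℝ) / 2) * (2 / σ) * μ⁻¹) := by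
  rw [lintegral_lintegral_swap (measurable_subordinatedDeriv_sq d σ μ).enorm.aemeasurable]
  set C : ℝ := (2 + d / 2) * 2 ^ ((d : ℝ) / 2) * (2 / σ) * μ⁻¹ with hC
  have hC0 : 0 ≤ C := by positivity
  have key : ∀ t ∈ Set.Ioi (0 : ℝ),
      ∫⁻ x : Fin d → ℝ, ‖subordinatedDeriv d σ μ (∑ i, x i ^ 2) t‖ₑ ≤
        ENNReal.ofReal C * ENNReal.ofReal (Real.exp (-t)) := by
    intro t ht
    have ht : 0 < t := ht
    have hs : 0 < t * μ ^ ((2 : ℝ) / σ) := by positivity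
    calc ∫⁻ x : Fin d → ℝ, ‖subordinatedDeriv d σ μ (∑ i, x i ^ 2) t‖ₑ
        ≤ ∫⁻ x : Fin d → ℝ, ENNReal.ofReal (C * Real.exp (-t)) * ENNReal.ofReal
            (heatProfile d (2 * (t * μ ^ ((2 : ℝ) / σ))) (∑ i, x i ^ 2)) := by
          refine lintegral_mono fun x => ?_
          rw [Real.enorm_eq_ofReal_abs, ← ENNReal.ofReal_mul (by positivity)]
          refine ENNReal.ofReal_le_ofReal ((abs_subordinatedDeriv_le d hμ ht hσ
            (Finset.sum_nonneg fun _ _ => sq_nonneg _)).trans_eq ?_)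
          rw [heatProfile_half d hs, hC]
          field_simp
      _ = ENNReal.ofReal C * ENNReal.ofReal (Real.exp (-t)) := by
          rw [lintegral_const_mul' _ _ ENNReal.ofReal_ne_top,
            lintegral_heatProfile d (by positivity), mul_one, ENNReal.ofReal_mul hC0]
  refine (setLIntegral_mono' measurableSet_Ioi key).trans_eq ?_
  rw [lintegral_const_mul' _ _ ENNReal.ofReal_ne_top,
    ← ofReal_integral_eq_lintegral_ofReal (integrableOn_exp_neg_Ioi 0)
      (Filter.Eventually.of_forall fun t => (Real.exp_pos _).le),
    integral_exp_neg_Ioi_zero, ENNReal.ofReal_one, mul_one]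

/-- for `x ≠ 0` the map `μ ↦ K_μ(x)` is differentiable on `(0,∞)`;
`∂_μ K_μ ∈ L¹(ℝ^d)` and `‖∂_μ K_μ‖_{L¹} ≤ C [μ]^{−σ} = C μ⁻¹` uniformly in `μ > 0`. -/
theorem stmt8 (d : ℕ) (hd : 1 ≤ d) (σ : ℝ) (hσ : 0 < σ) :
    (∀ x : Fin d → ℝ, x ≠ 0 → ∀ μ : ℝ, 0 < μ →
      DifferentiableAt ℝ (fun ν : ℝ => KkerR d σ ν x) μ) ∧
    ∃ C : ℝ, 0 < C ∧ ∀ μ : ℝ, 0 < μ →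
      Integrable (fun x : Fin d → ℝ => deriv (fun ν : ℝ => KkerR d σ ν x) μ) ∧
      (∫⁻ x : Fin d → ℝ, (‖deriv (fun ν : ℝ => KkerR d σ ν x) μ‖₊ : ℝ≥0∞)) ≤
        ENNReal.ofReal (C * μ⁻¹) := by
  refine ⟨fun x hx μ hμ => (hasDerivAt_KkerR hd hσ hμ hx).differentiableAt,
    (2 + d / 2) * 2 ^ ((d : ℝ) / 2) * (2 / σ), by positivity, fun μ hμ => ?_⟩
  have : Nonempty (Fin d) := ⟨⟨0, hd⟩⟩
  have hae : (fun x : Fin d → ℝ => deriv (fun ν : ℝ => KkerR d σ ν x) μ) =ᵐ[volume]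
      fun x => ∫ t in Set.Ioi (0 : ℝ), subordinatedDeriv d σ μ (∑ i, x i ^ 2) t := by
    filter_upwards [Measure.ae_ne volume (0 : Fin d → ℝ)] with x hx
    exact (hasDerivAt_KkerR hd hσ hμ hx).deriv
  have hle : ∫⁻ x : Fin d → ℝ, ‖deriv (fun ν : ℝ => KkerR d σ ν x) μ‖ₑ ≤
      ENNReal.ofReal ((2 + d / 2) * 2 ^ ((d : ℝ) / 2) * (2 / σ) * μ⁻¹) := by
    refine (lintegral_congr_ae (hae.fun_comp fun y => ‖y‖ₑ)).trans_le ?_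
    exact (lintegral_mono fun x => enorm_integral_le_lintegral_enorm _).trans
      (lintegral_subordinatedDeriv_le d hσ hμ)
  exact ⟨⟨(measurable_subordinatedDeriv_sq d σ μ).stronglyMeasurable.integral_prod_right'
    |>.aestronglyMeasurable.congr hae.symm,
    hle.trans_lt ENNReal.ofReal_lt_top⟩, hle⟩
end
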